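/- In the nested exponential family setting with switch criterion δ_sw, let M₁' be a CINECSI subset of M₁. Then there exist positive constants c₁, c₂ and b₁, b₂, b₃ such that for all μ₁ ∈ M₁' and all n: P_{μ₁}(δ_sw(Xⁿ) = 0) ≤ c₁·n^{m₁/2}·e^{−c₂·n·‖μ₁−μ₀‖₂²} + small_b(n), where μ₀ = Π₀(μ₁). As a consequence, with C' := c₂⁻¹(1 + m₁/2): for every sequence μ₁^{(1)}, μ₁^{(2)}, … in M₁' with f(n) := n‖μ₁^{(n)} − Π₀(μ₁^{(n)})‖₂²/log log n > C' log n for all n, one has P_{μ₁^{(n)}}(δ_sw(Xⁿ) = 0) ≤ c₁/n + small_b(n). -/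

import Mathlib

open MeasureTheory ProbabilityTheory Real Set
open scoped ENNReal BigOperators

noncomputable section

namespace SwitchPaper

variable {𝒳 : Type*} [MeasurableSpace 𝒳]

/-- Squared Euclidean distance `‖a − b‖₂²`. -/
def sqDist {m : ℕ} (a b : Fin m → ℝ) : ℝ := ∑ j, (a j - b j) ^ 2

/-- Euclidean inner product. -/
def dot {m : ℕ} (a b : Fin m → ℝ) : ℝ := ∑ j, a j * b j

/-- A CINECSI subset of `M`: a Connected subset of the interior of `M` that is itself
Compact and has NonEmpty interior. -/
def CINECSI {m : ℕ} (M' M : Set (Fin m → ℝ)) : Prop :=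
  IsConnected M' ∧ M' ⊆ interior M ∧ IsCompact M' ∧ (interior M').Nonempty

/-- Hellinger affinity `∫ √(p q) dν = E_{p}[√(q/p)]` between two densities w.r.t. `ν`. -/
def hellingerAffinity (ν : Measure 𝒳) (p q : 𝒳 → ℝ) : ℝ := ∫ x, Real.sqrt (p x * q x) ∂ν

/-- Squared Hellinger distance `d_{H²}(p,q) = 2(1 − E_p[√(q/p)])`. -/
def dH2 (ν : Measure 𝒳) (p q : 𝒳 → ℝ) : ℝ := 2 * (1 - hellingerAffinity ν p q)

/-- Rényi divergence of order 1/2, `d_R(p,q) = −2 log E_p[√(q/p)]`; it is symmetric. -/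
def dRenyiHalf (ν : Measure 𝒳) (p q : 𝒳 → ℝ) : ℝ := -2 * Real.log (hellingerAffinity ν p q)

/-- Kullback–Leibler divergence `D(p‖q) = ∫ p log(p/q) dν` between densities w.r.t. `ν`. -/
def klDiv' (ν : Measure 𝒳) (p q : 𝒳 → ℝ) : ℝ := ∫ x, p x * Real.log (p x / q x) ∂ν

/-- `p : M → 𝒳 → ℝ` is an `m`-dimensional exponential family w.r.t. the base measure `ν`,
given in its mean-value parameterization: the densities have the exponential form
`p_μ(x) = exp(θ(μ)ᵀ φ(x) − ψ(θ(μ))) r(x)`, each `p_μ` is a probability density w.r.t. `ν`,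
the mean of the sufficient statistic `φ` under `p_μ` is `μ`, the parameter set `M` is an
open connected product of open intervals, and the representation is minimal (the components
of `φ`, together with constants, are affinely independent). -/
structure IsMeanValueExpFam {m : ℕ} (ν : Measure 𝒳) (M : Set (Fin m → ℝ))
    (p : (Fin m → ℝ) → 𝒳 → ℝ) (θ : (Fin m → ℝ) → (Fin m → ℝ))
    (φ : 𝒳 → (Fin m → ℝ)) (ψ : (Fin m → ℝ) → ℝ) (carrier : 𝒳 → ℝ) : Prop where
  carrier_pos : ∀ x, 0 < carrier x
  φ_meas : Measurable φ
  p_meas : ∀ μ, Measurable (p μ)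
  M_conn : IsConnected M
  M_prod : ∃ S : Fin m → Set ℝ, (∀ j, IsOpen (S j) ∧ (S j).OrdConnected) ∧ M = Set.univ.pi S
  p_form : ∀ μ ∈ M, ∀ x, p μ x = Real.exp (dot (θ μ) (φ x) - ψ (θ μ)) * carrier x
  p_prob : ∀ μ ∈ M, ∫ x, p μ x ∂ν = 1
  φ_int : ∀ μ ∈ M, Integrable (fun x => (∑ j, |φ x j|) * p μ x) ν
  mean_eq : ∀ μ ∈ M, ∀ i, ∫ x, φ x i * p μ x ∂ν = μ i
  minimal : ∀ c : Fin m → ℝ, ∀ d : ℝ, (∀ x, dot c (φ x) = d) → c = 0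

/-- Covariance matrix of the sufficient statistic `φ` under `p_μ`. -/
def covMatrix {m : ℕ} (ν : Measure 𝒳) (p : (Fin m → ℝ) → 𝒳 → ℝ) (φ : 𝒳 → (Fin m → ℝ))
    (μ : Fin m → ℝ) : Matrix (Fin m) (Fin m) ℝ :=
  Matrix.of fun i j => ∫ x, (φ x i - μ i) * (φ x j - μ j) * p μ x ∂ν

/-- Fisher information matrix in the mean-value parameterization: the inverse of the
covariance matrix of the sufficient statistic. -/
def fisherInfo {m : ℕ} (ν : Measure 𝒳) (p : (Fin m → ℝ) → 𝒳 → ℝ) (φ : 𝒳 → (Fin m → ℝ))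
    (μ : Fin m → ℝ) : Matrix (Fin m) (Fin m) ℝ := (covMatrix ν p φ μ)⁻¹

/-- Quadratic form `vᵀ J v`. -/
def quadForm {m : ℕ} (J : Matrix (Fin m) (Fin m) ℝ) (v : Fin m → ℝ) : ℝ :=
  ∑ i, ∑ j, v i * J i j * v j

/-- Standardized squared error (squared Mahalanobis distance)
`d_ST(a ‖ b) = (b − a)ᵀ I(a) (b − a)`, with `I` the Fisher information. -/
def dST {m : ℕ} (ν : Measure 𝒳) (p : (Fin m → ℝ) → 𝒳 → ℝ) (φ : 𝒳 → (Fin m → ℝ))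
    (a b : Fin m → ℝ) : ℝ := quadForm (fisherInfo ν p φ a) (b - a)

/-- Joint density (likelihood) of an i.i.d. sample. -/
def likelihood {m : ℕ} (p : (Fin m → ℝ) → 𝒳 → ℝ) (μ : Fin m → ℝ) {n : ℕ}
    (xs : Fin n → 𝒳) : ℝ := ∏ i, p μ (xs i)

/-- The law of `n` i.i.d. observations, each with density `f` w.r.t. `ν`. -/
def iidLaw (ν : Measure 𝒳) (f : 𝒳 → ℝ) (n : ℕ) : Measure (Fin n → 𝒳) :=
  (Measure.pi fun _ : Fin n => ν).withDensity fun xs => ENNReal.ofReal (∏ i, f (xs i))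

/-- The (raw) maximum likelihood estimator of an exponential family in its mean-value
parameterization: the empirical mean of the sufficient statistic. -/
def mleRaw {m : ℕ} (φ : 𝒳 → (Fin m → ℝ)) {n : ℕ} (xs : Fin n → 𝒳) : Fin m → ℝ :=
  fun j => (∑ i, φ (xs i) j) / n

/-- Projection `Π₀` onto the simple model: keep the first `m₀` coordinates, replace the
remaining ones by the fixed values. -/
def proj0 {m₁ : ℕ} (m₀ : ℕ) (fixed : Fin m₁ → ℝ) (μ : Fin m₁ → ℝ) : Fin m₁ → ℝ :=
  fun j => if (j : ℕ) < m₀ then μ j else fixed j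

/-- The parameter set of the nested submodel `𝓜₀`: the last `m₁ − m₀` coordinates are
fixed to known values. -/
def nestedSub {m₁ : ℕ} (m₀ : ℕ) (M₁ : Set (Fin m₁ → ℝ)) (fixed : Fin m₁ → ℝ) :
    Set (Fin m₁ → ℝ) := {μ ∈ M₁ | ∀ j : Fin m₁, m₀ ≤ (j : ℕ) → μ j = fixed j}

/-- Embedding of the `m₀`-dimensional parameter of the simple model into `ℝ^{m₁}`. -/
def embed0 {m₀ m₁ : ℕ} (h : m₀ ≤ m₁) (fixed : Fin m₁ → ℝ) (t : Fin m₀ → ℝ) : Fin m₁ → ℝ :=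
  fun j => if hj : (j : ℕ) < m₀ then t ⟨(j : ℕ), hj⟩ else fixed j

/-- Bayes marginal density of a sample: `p_B(xⁿ) = ∫_M w(μ) p_μ(xⁿ) dμ`. -/
def bayesMarginal {m : ℕ} (p : (Fin m → ℝ) → 𝒳 → ℝ) (M : Set (Fin m → ℝ))
    (w : (Fin m → ℝ) → ℝ) {n : ℕ} (xs : Fin n → 𝒳) : ℝ :=
  ∫ μ in M, w μ * likelihood p μ xs

/-- The first `k` observations of a sample of size `n ≥ k`. -/
def prefixObs {n : ℕ} (xs : Fin n → 𝒳) (k : ℕ) (h : k ≤ n) : Fin k → 𝒳 :=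
  fun i => xs (Fin.castLE h i)

/-- The strategy `p̄_t` that switches from the simple to the complex model after `t − 1`
observations: `p̄_t(xⁿ) = p_{B,0}(x^{t−1}) · p_{B,1}(x_t,…,x_n | x^{t−1})`. -/
def pBar (pB0 pB1 : (k : ℕ) → (Fin k → 𝒳) → ℝ) (t : ℕ) {n : ℕ} (xs : Fin n → 𝒳) : ℝ :=
  if h : t - 1 < n then
    pB0 (t - 1) (prefixObs xs (t - 1) h.le) * pB1 n xs / pB1 (t - 1) (prefixObs xs (t - 1) h.le)
  else pB0 n xs

/-- The switch distribution `p_{sw,1}(xⁿ) = Σ_t π(t) p̄_t(xⁿ)`. -/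
def pSwitch (pB0 pB1 : (k : ℕ) → (Fin k → 𝒳) → ℝ) (pri : ℕ → ℝ) {n : ℕ} (xs : Fin n → 𝒳) : ℝ :=
  ∑' t : ℕ, pri t * pBar pB0 pB1 t xs

/-- A prior on switching times supported on powers of two, with `π(2^i) ∝ i^{−κ}`. -/
def SwitchPrior (pri : ℕ → ℝ) (κ : ℝ) : Prop :=
  (∀ t, 0 ≤ pri t) ∧ (∑' t : ℕ, pri t = 1) ∧ (∀ t, pri t ≠ 0 → ∃ i : ℕ, t = 2 ^ i) ∧ 0 < pri 1 ∧
    ∃ c > 0, ∀ i : ℕ, 1 ≤ i → pri (2 ^ i) = c * (i : ℝ) ^ (-κ)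

/-- The event (at sample size `n`) that the switch criterion selects the simple model,
i.e. `p_{sw,1}(xⁿ)/p_{B,0}(xⁿ) ≤ 1`. -/
def swSelectsSimple (pB0 pB1 : (k : ℕ) → (Fin k → 𝒳) → ℝ) (pri : ℕ → ℝ) (n : ℕ) :
    Set (Fin n → 𝒳) := {xs | pSwitch pB0 pB1 pri xs / pB0 n xs ≤ 1}

/-- `small_b(n)`: equal to `1` for `n < b₁` and to `b₂ e^{−b₃ n}` for `n ≥ b₁`. -/
def smallFn (b₁ b₂ b₃ : ℝ) (n : ℕ) : ℝ :=
  if (n : ℝ) < b₁ then 1 else b₂ * Real.exp (-b₃ * n)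

/-- Estimators `μ̆₀, μ̆₁` are sufficiently efficient (with constant `C`, on the set `M₁'`)
w.r.t. the divergence `dgen`: for all `n` and `μ₁ ∈ M₁'`, the risks
`E_{μ₁}[dgen(μ₀, μ̆₀(Xⁿ))]` and `E_{μ₁}[dgen(μ₁, μ̆₁(Xⁿ))]` are bounded by `C/n`,
where `μ₀ = Π₀(μ₁)`. -/
def SuffEff {m₁ : ℕ} (ν : Measure 𝒳) (p : (Fin m₁ → ℝ) → 𝒳 → ℝ) (m₀ : ℕ)
    (fixed : Fin m₁ → ℝ) (M₁' : Set (Fin m₁ → ℝ))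
    (dgen : (Fin m₁ → ℝ) → (Fin m₁ → ℝ) → ℝ)
    (est0 est1 : (n : ℕ) → (Fin n → 𝒳) → (Fin m₁ → ℝ)) (C : ℝ) : Prop :=
  0 < C ∧ ∀ n : ℕ, 0 < n → ∀ μ₁ ∈ M₁',
    (∫ xs, dgen (proj0 m₀ fixed μ₁) (est0 n xs) ∂(iidLaw ν (p μ₁) n)) ≤ C / n ∧
    (∫ xs, dgen μ₁ (est1 n xs) ∂(iidLaw ν (p μ₁) n)) ≤ C / n

end SwitchPaper

namespace SwitchPaper

section aux

lemma dot_add_l {m : ℕ} (a b c : Fin m → ℝ) : dot (a + b) c = dot a c + dot b c := by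
  simp [dot, add_mul, Finset.sum_add_distrib]
lemma dot_sub_l {m : ℕ} (a b c : Fin m → ℝ) : dot (a - b) c = dot a c - dot b c := by
  simp [dot, sub_mul, Finset.sum_sub_distrib]
lemma dot_smul_l {m : ℕ} (s : ℝ) (b c : Fin m → ℝ) : dot (s • b) c = s * dot b c := by
  simp [dot, mul_assoc, Finset.mul_sum]
lemma dot_comm {m : ℕ} (a b : Fin m → ℝ) : dot a b = dot b a := by
  simp [dot, mul_comm]
lemma dot_add_r {m : ℕ} (a b c : Fin m → ℝ) : dot c (a + b) = dot c a + dot c b := by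
  simp [dot, mul_add, Finset.sum_add_distrib]
lemma dot_sub_r {m : ℕ} (a b c : Fin m → ℝ) : dot c (a - b) = dot c a - dot c b := by
  simp [dot, mul_sub, Finset.sum_sub_distrib]
lemma dot_smul_r {m : ℕ} (s : ℝ) (b c : Fin m → ℝ) : dot c (s • b) = s * dot c b := by
  rw [dot_comm, dot_smul_l, dot_comm]
lemma dot_zero_l {m : ℕ} (c : Fin m → ℝ) : dot 0 c = 0 := by
  simp [dot]

lemma abs_dot_le_sum {m : ℕ} (a b : Fin m → ℝ) : |dot a b| ≤ ‖a‖ * ∑ j, |b j| := by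
  unfold dot
  refine (Finset.abs_sum_le_sum_abs _ _).trans ?_
  rw [Finset.mul_sum]
  refine Finset.sum_le_sum fun j _ => ?_
  rw [abs_mul]
  exact mul_le_mul_of_nonneg_right (norm_le_pi_norm a j) (abs_nonneg _)

lemma sum_abs_le {m : ℕ} (b : Fin m → ℝ) : ∑ j, |b j| ≤ m * ‖b‖ := by
  calc ∑ j, |b j| ≤ ∑ _j : Fin m, ‖b‖ := Finset.sum_le_sum fun j _ => norm_le_pi_norm b j
    _ = m * ‖b‖ := by simp

lemma abs_dot_le {m : ℕ} (a b : Fin m → ℝ) : |dot a b| ≤ m * ‖a‖ * ‖b‖ := by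
  refine (abs_dot_le_sum a b).trans ?_
  calc ‖a‖ * ∑ j, |b j| ≤ ‖a‖ * (m * ‖b‖) :=
        mul_le_mul_of_nonneg_left (sum_abs_le b) (norm_nonneg _)
    _ = _ := by ring

lemma dot_le {m : ℕ} (a b : Fin m → ℝ) : dot a b ≤ m * ‖a‖ * ‖b‖ :=
  (le_abs_self _).trans (abs_dot_le a b)

lemma norm_sq_le_dot {m : ℕ} (a : Fin m → ℝ) : ‖a‖ ^ 2 ≤ dot a a := by
  have h0 : 0 ≤ dot a a := Finset.sum_nonneg fun j _ => mul_self_nonneg _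
  have : ‖a‖ ≤ √(dot a a) := by
    rw [pi_norm_le_iff_of_nonneg (Real.sqrt_nonneg _)]
    intro j
    rw [Real.norm_eq_abs, ← Real.sqrt_sq_eq_abs]
    apply Real.sqrt_le_sqrt
    rw [pow_two]
    exact Finset.single_le_sum (f := fun j => a j * a j) (fun j _ => mul_self_nonneg _)
      (Finset.mem_univ j)
  calc ‖a‖ ^ 2 ≤ (√(dot a a)) ^ 2 := by gcongr
    _ = _ := Real.sq_sqrt h0

lemma continuous_dot {m : ℕ} : Continuous fun z : (Fin m → ℝ) × (Fin m → ℝ) => dot z.1 z.2 := by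
  unfold dot
  fun_prop

lemma exp_lower (y : ℝ) : y ^ 2 / 2 * exp (-|y|) ≤ exp y - 1 - y := by
  rcases le_total 0 y with h | h
  · have h1 := Real.quadratic_le_exp_of_nonneg h
    have h2 : exp (-|y|) ≤ 1 := by simp
    nlinarith [sq_nonneg y]
  · rw [abs_of_nonpos h, neg_neg]
    have key : 0 ≤ exp y * (1 - y ^ 2 / 2) - 1 - y := by
      have hmono : AntitoneOn (fun y => exp y * (1 - y ^ 2 / 2) - 1 - y) (Set.Iic 0) := by
        apply antitoneOn_of_deriv_nonpos (convex_Iic 0)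
        · fun_prop
        · fun_prop
        · intro x hx
          have hx' : x < 0 := by simpa using hx
          have hd : HasDerivAt (fun y : ℝ => exp y * (1 - y ^ 2 / 2) - 1 - y)
              (exp x * (1 - x ^ 2 / 2) + exp x * (0 - (2 * x ^ 1) / 2) - 1) x := by
            refine (((Real.hasDerivAt_exp x).mul
              ((hasDerivAt_const x (1:ℝ)).sub ((hasDerivAt_pow 2 x).div_const 2))).sub_const 1).sub
              (hasDerivAt_id x) |>.congr_deriv ?_
            norm_num
          rw [hd.deriv]
          have h1 := Real.quadratic_le_exp_of_nonneg (x := -x) (by linarith)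
          have h3 : exp x * exp (-x) = 1 := by rw [← Real.exp_add]; simp
          have hp := Real.exp_pos x
          have h4 : exp x * (1 + -x + (-x) ^ 2 / 2) ≤ 1 := by
            exact (mul_le_mul_of_nonneg_left h1 hp.le).trans h3.le
          nlinarith [mul_nonneg hp.le (sq_nonneg x)]
      have := hmono (show y ∈ Set.Iic 0 from h) (show (0:ℝ) ∈ Set.Iic 0 by simp) h
      simpa using this
    nlinarith

lemma exp_upper (y : ℝ) : exp y ≤ 1 + y + y ^ 2 * exp |y| := by
  have h := Real.abs_exp_sub_one_sub_id_le (x := y)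
  by_cases hy : |y| ≤ 1
  · have h1 := (abs_le.1 (h hy)).2
    have : (1:ℝ) ≤ exp |y| := by simp
    nlinarith [sq_nonneg y]
  · push Not at hy
    have h2 : exp y ≤ exp |y| := exp_le_exp.2 (le_abs_self _)
    have h3 : 1 ≤ y ^ 2 := by rw [← sq_abs]; nlinarith
    have h4 := Real.add_one_le_exp |y|
    have h5 := neg_abs_le y
    rcases le_total 0 y with h6 | h6
    · nlinarith [Real.exp_pos |y|]
    · have : exp y ≤ 1 := by simpa using h6
      rw [abs_of_nonpos h6] at *
      nlinarith [Real.exp_pos (-y)]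

end aux
end SwitchPaper
namespace SwitchPaper
section expfam
variable {𝒳 : Type*} [MeasurableSpace 𝒳] {m : ℕ} {ν : Measure 𝒳} {M : Set (Fin m → ℝ)}
  {p : (Fin m → ℝ) → 𝒳 → ℝ} {θ : (Fin m → ℝ) → (Fin m → ℝ)}
  {φ : 𝒳 → (Fin m → ℝ)} {ψ : (Fin m → ℝ) → ℝ} {r : 𝒳 → ℝ}

/-- KL-type divergence. -/
def DD (θ : (Fin m → ℝ) → (Fin m → ℝ)) (ψ : (Fin m → ℝ) → ℝ) (μ b : Fin m → ℝ) : ℝ :=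
  ψ (θ b) - ψ (θ μ) - dot (θ b - θ μ) μ

lemma DD_symm_sum (μ b : Fin m → ℝ) : DD θ ψ μ b + DD θ ψ b μ = dot (θ b - θ μ) (b - μ) := by
  simp only [DD, dot_sub_l, dot_sub_r]; ring

lemma ef_isOpen (hF : IsMeanValueExpFam ν M p θ φ ψ r) : IsOpen M := by
  obtain ⟨S, hS, rfl⟩ := hF.M_prod
  exact isOpen_set_pi Set.finite_univ fun j _ => (hS j).1

lemma ef_convex (hF : IsMeanValueExpFam ν M p θ φ ψ r) : Convex ℝ M := by
  obtain ⟨S, hS, rfl⟩ := hF.M_prod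
  exact convex_pi fun j _ => (hS j).2.convex

lemma ef_pos (hF : IsMeanValueExpFam ν M p θ φ ψ r) {μ} (hμ : μ ∈ M) (x : 𝒳) : 0 < p μ x := by
  rw [hF.p_form μ hμ]; exact mul_pos (exp_pos _) (hF.carrier_pos x)

lemma ef_int (hF : IsMeanValueExpFam ν M p θ φ ψ r) {μ} (hμ : μ ∈ M) : Integrable (p μ) ν := by
  apply Integrable.of_integral_ne_zero
  rw [hF.p_prob μ hμ]; exact one_ne_zero

lemma ef_φj_meas (hF : IsMeanValueExpFam ν M p θ φ ψ r) (j : Fin m) :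
    Measurable fun x => φ x j := (measurable_pi_apply j).comp hF.φ_meas

lemma ef_dot_meas (hF : IsMeanValueExpFam ν M p θ φ ψ r) (h μ : Fin m → ℝ) :
    Measurable fun x => dot h (φ x - μ) := by
  unfold dot
  exact Finset.measurable_sum _ fun j _ => ((ef_φj_meas hF j).sub_const _).const_mul _

lemma ef_N_meas (hF : IsMeanValueExpFam ν M p θ φ ψ r) :
    Measurable fun x => ∑ j, |φ x j| :=
  Finset.measurable_sum _ fun j _ => (ef_φj_meas hF j).abs

lemma ef_φj_int (hF : IsMeanValueExpFam ν M p θ φ ψ r) {μ} (hμ : μ ∈ M) (j : Fin m) :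
    Integrable (fun x => φ x j * p μ x) ν := by
  refine (hF.φ_int μ hμ).mono' ((ef_φj_meas hF j).mul (hF.p_meas μ)).aestronglyMeasurable ?_
  refine Filter.Eventually.of_forall fun x => ?_
  rw [norm_mul, Real.norm_eq_abs, Real.norm_eq_abs, abs_of_pos (ef_pos hF hμ x)]
  exact mul_le_mul_of_nonneg_right
    (Finset.single_le_sum (f := fun j => |φ x j|) (fun j _ => abs_nonneg _) (Finset.mem_univ j))
    (ef_pos hF hμ x).le

lemma ef_dot_int (hF : IsMeanValueExpFam ν M p θ φ ψ r) {μ} (hμ : μ ∈ M) (h b : Fin m → ℝ) :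
    Integrable (fun x => dot h (φ x - b) * p μ x) ν ∧
      ∫ x, dot h (φ x - b) * p μ x ∂ν = dot h (μ - b) := by
  have e : (fun x => dot h (φ x - b) * p μ x) =
      fun x => (∑ j, h j * (φ x j * p μ x)) - dot h b * p μ x := by
    funext x
    rw [dot_sub_r, sub_mul]
    simp only [dot, Finset.sum_mul, mul_assoc]
  have i1 : ∀ j ∈ Finset.univ, Integrable (fun x => h j * (φ x j * p μ x)) ν := fun j _ =>
    (ef_φj_int hF hμ j).const_mul _
  have i2 : Integrable (fun x => dot h b * p μ x) ν := (ef_int hF hμ).const_mul _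
  rw [e]
  refine ⟨(integrable_finsetSum _ i1).sub i2, ?_⟩
  rw [integral_sub (integrable_finsetSum _ i1) i2, integral_finsetSum _ i1]
  simp only [integral_const_mul, hF.mean_eq μ hμ, hF.p_prob μ hμ, dot_sub_r, mul_one]
  rfl

lemma ef_ratio (hF : IsMeanValueExpFam ν M p θ φ ψ r) {μ b} (hμ : μ ∈ M) (hb : b ∈ M) (x : 𝒳) :
    exp (dot (θ b - θ μ) (φ x - μ)) * p μ x = exp (DD θ ψ μ b) * p b x := by
  rw [hF.p_form μ hμ, hF.p_form b hb, ← mul_assoc, ← mul_assoc, ← exp_add, ← exp_add]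
  congr 2
  simp only [DD, dot_sub_l, dot_sub_r]; ring

lemma ef_mgf (hF : IsMeanValueExpFam ν M p θ φ ψ r) {μ b} (hμ : μ ∈ M) (hb : b ∈ M) :
    Integrable (fun x => exp (dot (θ b - θ μ) (φ x - μ)) * p μ x) ν ∧
      ∫ x, exp (dot (θ b - θ μ) (φ x - μ)) * p μ x ∂ν = exp (DD θ ψ μ b) := by
  simp only [ef_ratio hF hμ hb]
  exact ⟨(ef_int hF hb).const_mul _, by rw [integral_const_mul, hF.p_prob b hb, mul_one]⟩

/-- Jensen for the exponential. -/
lemma ef_jensen (hF : IsMeanValueExpFam ν M p θ φ ψ r) {μ} (hμ : μ ∈ M) (h : Fin m → ℝ)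
    (hi : Integrable (fun x => exp (dot h (φ x - μ)) * p μ x) ν) :
    1 ≤ ∫ x, exp (dot h (φ x - μ)) * p μ x ∂ν := by
  obtain ⟨i1, i2⟩ := ef_dot_int hF hμ h μ
  have : ∫ x, (dot h (φ x - μ) * p μ x + p μ x) ∂ν = 1 := by
    rw [integral_add i1 (ef_int hF hμ), i2, hF.p_prob μ hμ]; simp [dot]
  rw [← this]
  refine integral_mono (i1.add (ef_int hF hμ)) hi fun x => ?_
  have := Real.add_one_le_exp (dot h (φ x - μ))
  have h2 := ef_pos hF hμ x
  simp only
  nlinarith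

lemma DD_nonneg (hF : IsMeanValueExpFam ν M p θ φ ψ r) {μ b} (hμ : μ ∈ M) (hb : b ∈ M) :
    0 ≤ DD θ ψ μ b := by
  obtain ⟨h1, h2⟩ := ef_mgf hF hμ hb
  have := ef_jensen hF hμ _ h1
  rw [h2] at this
  simpa using this

lemma DD_le (hF : IsMeanValueExpFam ν M p θ φ ψ r) {μ b} (hμ : μ ∈ M) (hb : b ∈ M) :
    DD θ ψ μ b ≤ dot (θ b - θ μ) (b - μ) := by
  have := DD_symm_sum (θ := θ) (ψ := ψ) μ b
  have := DD_nonneg hF hb hμ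
  linarith

/-- Conjugate. -/
def As (θ : (Fin m → ℝ) → (Fin m → ℝ)) (ψ : (Fin m → ℝ) → ℝ) (μ : Fin m → ℝ) : ℝ :=
  dot (θ μ) μ - ψ (θ μ)

lemma As_sub (hF : IsMeanValueExpFam ν M p θ φ ψ r) {μ b} (hμ : μ ∈ M) (hb : b ∈ M) :
    As θ ψ μ + dot (θ μ) (b - μ) ≤ As θ ψ b := by
  have := DD_nonneg hF hb hμ
  simp only [DD, As, dot_sub_l, dot_sub_r] at *
  linarith

lemma As_convex (hF : IsMeanValueExpFam ν M p θ φ ψ r) : ConvexOn ℝ M (As θ ψ) := by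
  refine ⟨ef_convex hF, fun x hx y hy a b ha hb hab => ?_⟩
  have hz := ef_convex hF hx hy ha hb hab
  have h1 := As_sub hF hz hx
  have h2 := As_sub hF hz hy
  set z := a • x + b • y with hzd
  have h3 : a * dot (θ z) (x - z) + b * dot (θ z) (y - z) = 0 := by
    rw [← dot_smul_r, ← dot_smul_r, ← dot_add_r]
    have : a • (x - z) + b • (y - z) = 0 := by
      have : a • (x - z) + b • (y - z) = z - (a + b) • z := by
        rw [hzd]; module
      rw [this, hab]; simp
    rw [this, dot_comm, dot_zero_l]
  simp only [smul_eq_mul]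
  have h4 := mul_le_mul_of_nonneg_left h1 ha
  have h5 := mul_le_mul_of_nonneg_left h2 hb
  have h6 : As θ ψ z = a * As θ ψ z + b * As θ ψ z := by rw [← add_mul, hab, one_mul]
  rw [h6]
  linarith

lemma As_cont (hF : IsMeanValueExpFam ν M p θ φ ψ r) : ContinuousOn (As θ ψ) M :=
  (As_convex hF).continuousOn (ef_isOpen hF)

lemma ef_bdd (hF : IsMeanValueExpFam ν M p θ φ ψ r) {K : Set (Fin m → ℝ)} (hK : IsCompact K)
    (hKM : K ⊆ M) : ∃ B > 0, ∀ μ ∈ K, ‖θ μ‖ ≤ B ∧ |ψ (θ μ)| ≤ B ∧ ‖μ‖ ≤ B := by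
  obtain ⟨ρ, hρ, hsub⟩ := hK.exists_cthickening_subset_open (ef_isOpen hF) hKM
  obtain ⟨C, hC⟩ := (hK.cthickening (r := ρ)).exists_bound_of_continuousOn
    ((As_cont hF).mono hsub)
  obtain ⟨C2, hC2⟩ := hK.exists_bound_of_continuousOn (f := fun x => x) continuousOn_id
  have hmem : ∀ μ ∈ K, ∀ v : Fin m → ℝ, ‖v‖ ≤ ρ → μ + v ∈ Metric.cthickening ρ K := by
    intro μ hμ v hv
    exact Metric.mem_cthickening_of_dist_le _ μ _ _ hμ (by simpa [dist_eq_norm] using hv)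
  have hθ : ∀ μ ∈ K, ‖θ μ‖ ≤ 2 * |C| / ρ := by
    intro μ hμ
    rw [pi_norm_le_iff_of_nonneg (by positivity)]
    intro j
    have key : ∀ s : ℝ, |s| = 1 → s * θ μ j ≤ 2 * |C| / ρ := by
      intro s hs
      have hv : ‖(Pi.single j (s * ρ) : Fin m → ℝ)‖ ≤ ρ := by
        rw [Pi.norm_single, norm_mul, Real.norm_eq_abs, hs, one_mul, Real.norm_eq_abs, abs_of_pos hρ]
      have h1 := hmem μ hμ _ hv
      have h2 := As_sub hF (hKM hμ) (hsub h1)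
      have h3 := hC _ h1
      have h4 := hC μ (Metric.self_subset_cthickening K hμ)
      rw [add_sub_cancel_left] at h2
      have h5 : dot (θ μ) (Pi.single j (s * ρ)) = θ μ j * (s * ρ) := by
        simp [dot, Pi.single_apply]
      rw [h5] at h2
      rw [Real.norm_eq_abs] at h3 h4
      rw [le_div_iff₀ hρ]
      have := abs_le.1 h3
      have := abs_le.1 h4
      have := le_abs_self C
      nlinarith
    rw [Real.norm_eq_abs, abs_le]
    have h1 := key 1 (by simp)
    have h2 := key (-1) (by simp)
    constructor <;> linarith
  set T := 2 * |C| / ρ with hT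
  have hT0 : 0 ≤ T := by positivity
  refine ⟨T + |C2| + (m * T * |C2| + |C|) + 1, by positivity, fun μ hμ => ?_⟩
  have a1 := hθ μ hμ
  have a2 : ‖μ‖ ≤ |C2| := (hC2 μ hμ).trans (le_abs_self _)
  have a3 : |As θ ψ μ| ≤ |C| :=
    (hC μ (Metric.self_subset_cthickening K hμ)).trans (le_abs_self _)
  have a4 : |dot (θ μ) μ| ≤ m * T * |C2| := (abs_dot_le _ _).trans (by gcongr)
  have a5 : |ψ (θ μ)| ≤ m * T * |C2| + |C| := by
    have : ψ (θ μ) = dot (θ μ) μ - As θ ψ μ := by simp [As]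
    rw [this]
    exact (abs_sub _ _).trans (by linarith)
  have := abs_nonneg C
  have := abs_nonneg C2
  have : 0 ≤ m * T * |C2| := by positivity
  refine ⟨by linarith, by linarith, by linarith⟩

end expfam
end SwitchPaper
namespace SwitchPaper
section expfam3
variable {𝒳 : Type*} [MeasurableSpace 𝒳] {m : ℕ} {ν : Measure 𝒳} {M : Set (Fin m → ℝ)}
  {p : (Fin m → ℝ) → 𝒳 → ℝ} {θ : (Fin m → ℝ) → (Fin m → ℝ)}
  {φ : 𝒳 → (Fin m → ℝ)} {ψ : (Fin m → ℝ) → ℝ} {r : 𝒳 → ℝ}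

lemma ef_nondeg (hF : IsMeanValueExpFam ν M p θ φ ψ r) (h : Fin m → ℝ) (d : ℝ)
    (hh : ∀ᵐ x ∂ν, dot h (φ x) = d) : h = 0 ∧ d = 0 := by
  have h1 : ∀ μ ∈ M, dot h μ = d := by
    intro μ hμ
    obtain ⟨i1, i2⟩ := ef_dot_int hF hμ h 0
    simp only [sub_zero] at i2
    rw [← i2, ← mul_one d, ← hF.p_prob μ hμ, ← integral_const_mul]
    apply integral_congr_ae
    filter_upwards [hh] with x hx
    rw [hx]
  obtain ⟨μ, hμ⟩ := hF.M_conn.nonempty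
  have h0 : h = 0 := by
    obtain ⟨ε, hε, hb⟩ := Metric.isOpen_iff.1 (ef_isOpen hF) μ hμ
    set s : ℝ := ε / (2 * (‖h‖ + 1)) with hs
    have hs0 : 0 < s := by positivity
    have h2 : μ + s • h ∈ M := by
      apply hb
      rw [Metric.mem_ball, dist_eq_norm, add_sub_cancel_left, norm_smul, Real.norm_eq_abs,
        abs_of_pos hs0, hs, div_mul_eq_mul_div, div_lt_iff₀ (by positivity)]
      nlinarith [norm_nonneg h]
    have h3 := h1 _ h2
    rw [dot_add_r, h1 _ hμ, dot_smul_r] at h3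
    have h4 : dot h h = 0 := by
      have : s * dot h h = 0 := by linarith
      rcases mul_eq_zero.1 this with h | h
      · exact absurd h hs0.ne'
      · exact h
    have := norm_sq_le_dot h
    rw [h4] at this
    have : ‖h‖ = 0 := by nlinarith [norm_nonneg h]
    simpa using this
  refine ⟨h0, ?_⟩
  rw [← h1 μ hμ, h0, dot_zero_l]

lemma ef_form (hF : IsMeanValueExpFam ν M p θ φ ψ r) {μ} (hμ : μ ∈ M) {B : ℝ}
    (h1 : ‖θ μ‖ ≤ B) (h2 : |ψ (θ μ)| ≤ B) (x : 𝒳) :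
    exp (-B * (∑ j, |φ x j|) - B) * r x ≤ p μ x := by
  rw [hF.p_form μ hμ]
  refine mul_le_mul_of_nonneg_right (exp_le_exp.2 ?_) (hF.carrier_pos x).le
  have a := abs_dot_le_sum (θ μ) (φ x)
  have hN : 0 ≤ ∑ j, |φ x j| := Finset.sum_nonneg fun j _ => abs_nonneg _
  have b := mul_le_mul_of_nonneg_right h1 hN
  have := neg_abs_le (dot (θ μ) (φ x))
  have := le_abs_self (ψ (θ μ))
  linarith

/-- weight -/
def WW (φ : 𝒳 → (Fin m → ℝ)) (r : 𝒳 → ℝ) (B : ℝ) (x : 𝒳) : ℝ :=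
  exp (-(B + 1) * ∑ j, |φ x j|) * r x

lemma ef_carrier_meas (hF : IsMeanValueExpFam ν M p θ φ ψ r) : Measurable r := by
  obtain ⟨μ, hμ⟩ := hF.M_conn.nonempty
  have : r = fun x => exp (-(dot (θ μ) (φ x - 0) - ψ (θ μ))) * p μ x := by
    funext x
    rw [hF.p_form μ hμ, ← mul_assoc, ← exp_add]; simp
  rw [this]
  exact (Real.measurable_exp.comp (((ef_dot_meas hF _ _).sub_const _).neg)).mul (hF.p_meas μ)

lemma WW_meas (hF : IsMeanValueExpFam ν M p θ φ ψ r) (B : ℝ) : Measurable (WW φ r B) :=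
  (Real.measurable_exp.comp ((ef_N_meas hF).const_mul _)).mul (ef_carrier_meas hF)

lemma WW_int (hF : IsMeanValueExpFam ν M p θ φ ψ r) {μ} (hμ : μ ∈ M) {B : ℝ}
    (h1 : ‖θ μ‖ ≤ B) (h2 : |ψ (θ μ)| ≤ B) :
    Integrable (fun x => ((∑ j, |φ x j|) + 1) ^ 2 * WW φ r B x) ν := by
  refine ((ef_int hF hμ).const_mul (4 * exp B)).mono'
    (((((ef_N_meas hF).add_const 1).pow_const 2)).mul (WW_meas hF B)).aestronglyMeasurable ?_
  refine Filter.Eventually.of_forall fun x => ?_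
  have hr := hF.carrier_pos x
  have hf := ef_form hF hμ h1 h2 x
  set N := ∑ j, |φ x j| with hNd
  have hN : 0 ≤ N := Finset.sum_nonneg fun j _ => abs_nonneg _
  have e1 : (N + 1) ^ 2 ≤ 4 * exp N := by
    have := Real.add_one_le_exp (N / 2)
    have e : exp N = exp (N / 2) ^ 2 := by rw [← Real.exp_nat_mul]; congr 1; push_cast; ring
    rw [e]
    nlinarith
  have e2 : WW φ r B x = exp (-N) * exp B * (exp (-B * N - B) * r x) := by
    rw [WW, ← hNd, ← mul_assoc, ← exp_add, ← exp_add]; congr 2; ring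
  rw [e2, Real.norm_eq_abs, abs_of_nonneg (by positivity)]
  have e3 : exp N * exp (-N) = 1 := by rw [← exp_add]; simp
  calc (N + 1) ^ 2 * (exp (-N) * exp B * (exp (-B * N - B) * r x))
      ≤ (4 * exp N) * (exp (-N) * exp B * p μ x) := by gcongr
    _ = 4 * exp B * p μ x * (exp N * exp (-N)) := by ring
    _ = _ := by rw [e3, mul_one]

lemma WW_sq_le (x : 𝒳) (h : Fin m → ℝ) (d R : ℝ) (h1 : ‖h‖ ≤ R) (h2 : |d| ≤ R) :
    (dot h (φ x) - d) ^ 2 ≤ R ^ 2 * ((∑ j, |φ x j|) + 1) ^ 2 := by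
  rw [← mul_pow, ← sq_abs]
  have a := abs_dot_le_sum h (φ x)
  have hN : 0 ≤ ∑ j, |φ x j| := Finset.sum_nonneg fun j _ => abs_nonneg _
  have b := mul_le_mul_of_nonneg_right h1 hN
  have c : |dot h (φ x) - d| ≤ |dot h (φ x)| + |d| := abs_sub _ _
  gcongr
  linarith

lemma WW_sq_meas (hF : IsMeanValueExpFam ν M p θ φ ψ r) (B : ℝ) (h : Fin m → ℝ) (d : ℝ) :
    AEStronglyMeasurable (fun x => (dot h (φ x) - d) ^ 2 * WW φ r B x) ν := by
  have := ef_dot_meas hF h 0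
  simp only [sub_zero] at this
  exact (((this.sub_const d).pow_const 2).mul (WW_meas hF B)).aestronglyMeasurable

lemma WW_sq_int (hF : IsMeanValueExpFam ν M p θ φ ψ r) {μ} (hμ : μ ∈ M) {B : ℝ}
    (h1 : ‖θ μ‖ ≤ B) (h2 : |ψ (θ μ)| ≤ B) (h : Fin m → ℝ) (d : ℝ) :
    Integrable (fun x => (dot h (φ x) - d) ^ 2 * WW φ r B x) ν := by
  refine ((WW_int hF hμ h1 h2).const_mul ((‖h‖ + |d|) ^ 2)).mono' (WW_sq_meas hF B h d) ?_
  refine Filter.Eventually.of_forall fun x => ?_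
  have hW : 0 < WW φ r B x := mul_pos (exp_pos _) (hF.carrier_pos x)
  rw [Real.norm_eq_abs, abs_of_nonneg (by positivity), ← mul_assoc]
  exact mul_le_mul_of_nonneg_right (WW_sq_le x h d _ (by simp) (by simp)) hW.le

lemma WW_form_pos (hF : IsMeanValueExpFam ν M p θ φ ψ r) {μ} (hμ : μ ∈ M) {B : ℝ}
    (h1 : ‖θ μ‖ ≤ B) (h2 : |ψ (θ μ)| ≤ B) :
    ∃ q > 0, ∀ (h : Fin m → ℝ) (d : ℝ),
      q * ‖h‖ ^ 2 ≤ ∫ x, (dot h (φ x) - d) ^ 2 * WW φ r B x ∂ν := by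
  have hWp : ∀ x, 0 < WW φ r B x := fun x => mul_pos (exp_pos _) (hF.carrier_pos x)
  set Q : (Fin m → ℝ) × ℝ → ℝ := fun z => ∫ x, (dot z.1 (φ x) - z.2) ^ 2 * WW φ r B x ∂ν with hQ
  have hcont : ContinuousOn Q (Metric.sphere 0 1) := by
    refine continuousOn_of_dominated (bound := fun x => ((∑ j, |φ x j|) + 1) ^ 2 * WW φ r B x)
      (fun z _ => WW_sq_meas hF B _ _) ?_ (WW_int hF hμ h1 h2) ?_
    · intro z hz
      refine Filter.Eventually.of_forall fun x => ?_
      rw [mem_sphere_zero_iff_norm] at hz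
      have a1 : ‖z.1‖ ≤ 1 := (norm_fst_le z).trans hz.le
      have a2 : |z.2| ≤ 1 := (norm_snd_le z).trans hz.le
      have := hWp x
      rw [Real.norm_eq_abs, abs_of_nonneg (by positivity)]
      refine mul_le_mul_of_nonneg_right ?_ this.le
      simpa using WW_sq_le x z.1 z.2 1 a1 a2
    · refine Filter.Eventually.of_forall fun x => ?_
      have : Continuous fun z : (Fin m → ℝ) × ℝ => dot z.1 (φ x) := by unfold dot; fun_prop
      exact (((this.sub continuous_snd).pow 2).mul continuous_const).continuousOn
  have hne : (Metric.sphere (0 : (Fin m → ℝ) × ℝ) 1).Nonempty := ⟨(0, 1), by simp⟩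
  obtain ⟨z0, hz0, hmin⟩ := (isCompact_sphere (0 : (Fin m → ℝ) × ℝ) 1).exists_isMinOn hne hcont
  have hpos : 0 < Q z0 := by
    have hnn : 0 ≤ fun x => (dot z0.1 (φ x) - z0.2) ^ 2 * WW φ r B x := fun x =>
      mul_nonneg (sq_nonneg _) (hWp x).le
    refine lt_of_le_of_ne (integral_nonneg hnn) fun h => ?_
    have h' := (integral_eq_zero_iff_of_nonneg hnn (WW_sq_int hF hμ h1 h2 _ _)).1 h.symm
    have h3 : ∀ᵐ x ∂ν, dot z0.1 (φ x) = z0.2 := by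
      filter_upwards [h'] with x hx
      rcases mul_eq_zero.1 hx with h | h
      · have := pow_eq_zero_iff (two_ne_zero) |>.1 h
        linarith
      · exact absurd h (hWp x).ne'
    obtain ⟨e1, e2⟩ := ef_nondeg hF _ _ h3
    have : z0 = 0 := Prod.ext e1 e2
    rw [this] at hz0
    simp at hz0
  refine ⟨Q z0, hpos, fun h d => ?_⟩
  by_cases hh : h = 0
  · rw [hh]; simp only [norm_zero]
    rw [zero_pow two_ne_zero, mul_zero]
    exact integral_nonneg fun x => mul_nonneg (sq_nonneg _) (hWp x).le
  set s := ‖((h, d) : (Fin m → ℝ) × ℝ)‖ with hs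
  have hhs : ‖h‖ ≤ s := norm_fst_le (h, d)
  have hs0 : 0 < s := lt_of_lt_of_le (norm_pos_iff.2 hh) hhs
  have hm : (s⁻¹ • (h, d) : (Fin m → ℝ) × ℝ) ∈ Metric.sphere (0 : (Fin m → ℝ) × ℝ) 1 := by
    rw [mem_sphere_zero_iff_norm, norm_smul, ← hs, norm_inv, Real.norm_eq_abs, abs_of_pos hs0]
    exact inv_mul_cancel₀ hs0.ne'
  have h3 : Q z0 ≤ Q (s⁻¹ • (h, d)) := hmin hm
  have h4 : Q (s⁻¹ • (h, d)) = (s⁻¹) ^ 2 * ∫ x, (dot h (φ x) - d) ^ 2 * WW φ r B x ∂ν := by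
    rw [← integral_const_mul]
    refine integral_congr_ae (Filter.Eventually.of_forall fun x => ?_)
    simp only [Prod.smul_fst, Prod.smul_snd, dot_smul_l, smul_eq_mul]
    ring
  rw [h4] at h3
  have h5 : Q z0 * s ^ 2 ≤ ∫ x, (dot h (φ x) - d) ^ 2 * WW φ r B x ∂ν := by
    calc Q z0 * s ^ 2 ≤ _ := mul_le_mul_of_nonneg_right h3 (sq_nonneg s)
      _ = _ := by field_simp
  refine le_trans ?_ h5
  gcongr

/-- Strong convexity, uniform on compacts. -/
lemma ef_strong (hF : IsMeanValueExpFam ν M p θ φ ψ r) {K : Set (Fin m → ℝ)} (hK : IsCompact K)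
    (hKM : K ⊆ M) (hKn : K.Nonempty) : ∃ c > 0, ∀ μ ∈ K, ∀ b ∈ M,
      c * min (‖θ b - θ μ‖ ^ 2) (‖θ b - θ μ‖) ≤ DD θ ψ μ b := by
  obtain ⟨B, hB, hBK⟩ := ef_bdd hF hK hKM
  obtain ⟨μs, hμs⟩ := hKn
  obtain ⟨q, hq, hqf⟩ := WW_form_pos hF (hKM hμs) (hBK _ hμs).1 (hBK _ hμs).2.1
  set q' : ℝ := q * (exp (-(m * B) - B) / 2) with hq'
  have hq'0 : 0 < q' := by positivity
  -- small directions
  have key : ∀ μ ∈ K, ∀ h : Fin m → ℝ, ‖h‖ ≤ 1 →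
      Integrable (fun x => exp (dot h (φ x - μ)) * p μ x) ν →
      1 + q' * ‖h‖ ^ 2 ≤ ∫ x, exp (dot h (φ x - μ)) * p μ x ∂ν := by
    intro μ hμ h hh hi
    obtain ⟨i1, i2⟩ := ef_dot_int hF (hKM hμ) h μ
    have i3 := ef_int hF (hKM hμ)
    have i4 := (WW_sq_int hF (hKM hμs) (hBK _ hμs).1 (hBK _ hμs).2.1 h (dot h μ)).mul_const
      (exp (-(m * B) - B) / 2)
    have i5 : ∫ x, ((dot h (φ x - μ) * p μ x + p μ x) +
        (dot h (φ x) - dot h μ) ^ 2 * WW φ r B x * (exp (-(m * B) - B) / 2)) ∂ν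
        ≤ ∫ x, exp (dot h (φ x - μ)) * p μ x ∂ν := by
      refine integral_mono ((i1.add i3).add i4) hi fun x => ?_
      simp only
      have e1 := exp_lower (dot h (φ x - μ))
      have e2 := ef_form hF (hKM hμ) (hBK _ hμ).1 (hBK _ hμ).2.1 x
      have hr := hF.carrier_pos x
      have hN : 0 ≤ ∑ j, |φ x j| := Finset.sum_nonneg fun j _ => abs_nonneg _
      have e3 : |dot h (φ x - μ)| ≤ (∑ j, |φ x j|) + m * B := by
        rw [dot_sub_r]
        refine (abs_sub _ _).trans (add_le_add ?_ ?_)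
        · refine (abs_dot_le_sum _ _).trans ?_
          nlinarith
        · refine (abs_dot_le _ _).trans ?_
          have : (m:ℝ) * ‖h‖ ≤ m := mul_le_of_le_one_right (by positivity) hh
          exact mul_le_mul this (hBK _ hμ).2.2 (norm_nonneg _) (by positivity)
      have e4 : exp (-((∑ j, |φ x j|) + m * B)) ≤ exp (-|dot h (φ x - μ)|) :=
        exp_le_exp.2 (by linarith)
      have e5 : (dot h (φ x) - dot h μ) ^ 2 * WW φ r B x * (exp (-(m * B) - B) / 2) =
          dot h (φ x - μ) ^ 2 / 2 * exp (-((∑ j, |φ x j|) + m * B)) *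
            (exp (-B * (∑ j, |φ x j|) - B) * r x) := by
        have : exp (-(B + 1) * ∑ j, |φ x j|) * exp (-(m * B) - B) =
          exp (-((∑ j, |φ x j|) + m * B)) * exp (-B * (∑ j, |φ x j|) - B) := by
          rw [← exp_add, ← exp_add]; congr 1; ring
        rw [WW, ← dot_sub_r]
        linear_combination (dot h (φ x - μ) ^ 2 * r x / 2) * this
      rw [e5]
      have e6 : dot h (φ x - μ) ^ 2 / 2 * exp (-((∑ j, |φ x j|) + m * B)) *
            (exp (-B * (∑ j, |φ x j|) - B) * r x) ≤
          dot h (φ x - μ) ^ 2 / 2 * exp (-|dot h (φ x - μ)|) * p μ x := by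
        gcongr
      have e7 := mul_le_mul_of_nonneg_right e1 (ef_pos hF (hKM hμ) x).le
      nlinarith
    have i6 : ∫ x, ((dot h (φ x - μ) * p μ x + p μ x) +
        (dot h (φ x) - dot h μ) ^ 2 * WW φ r B x * (exp (-(m * B) - B) / 2)) ∂ν =
        0 + 1 + (∫ x, (dot h (φ x) - dot h μ) ^ 2 * WW φ r B x ∂ν) * (exp (-(m * B) - B) / 2) := by
      have i13 : Integrable (fun x => dot h (φ x - μ) * p μ x + p μ x) ν := i1.add i3
      rw [integral_add i13 i4, integral_add i1 i3, i2, hF.p_prob μ (hKM hμ),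
        integral_mul_const]
      simp [dot]
    rw [i6] at i5
    refine le_trans ?_ i5
    have := mul_le_mul_of_nonneg_right (hqf h (dot h μ))
      (show 0 ≤ exp (-(m * B) - B) / 2 by positivity)
    rw [hq']
    linarith
  have hlog : ∀ t : ℝ, 0 ≤ t → t ≤ 1 → t * Real.log (1 + q') ≤ Real.log (1 + q' * t) := by
    intro t ht ht1
    have := strictConcaveOn_log_Ioi.concaveOn.2 (show (1:ℝ) ∈ Set.Ioi 0 by simp)
      (show 1 + q' ∈ Set.Ioi 0 by simp; linarith) (show 0 ≤ 1 - t by linarith) ht (by ring)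
    simp only [smul_eq_mul, Real.log_one, mul_zero, zero_add] at this
    refine this.trans (le_of_eq ?_)
    congr 1; ring
  refine ⟨Real.log (1 + q'), Real.log_pos (by linarith), fun μ hμ b hb => ?_⟩
  obtain ⟨g1, g2⟩ := ef_mgf hF (hKM hμ) hb
  set u := θ b - θ μ with hu
  have hl0 : 0 < Real.log (1 + q') := Real.log_pos (by linarith)
  rcases le_total ‖u‖ 1 with hu1 | hu1
  · have h1 := key μ hμ u hu1 g1
    rw [g2] at h1
    have h2 : Real.log (1 + q' * ‖u‖ ^ 2) ≤ DD θ ψ μ b := by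
      rw [Real.log_le_iff_le_exp (by positivity)]; exact h1
    have h3 := hlog (‖u‖ ^ 2) (by positivity) (by nlinarith [norm_nonneg u])
    calc _ ≤ Real.log (1 + q') * ‖u‖ ^ 2 := by gcongr; exact min_le_left _ _
      _ ≤ _ := by linarith
  · have hup : 0 < ‖u‖ := by linarith
    set l := ‖u‖⁻¹ with hl
    have hlp : 0 < l := by positivity
    have hl1 : l ≤ 1 := inv_le_one_of_one_le₀ hu1
    have hpt : ∀ x, exp (dot (l • u) (φ x - μ)) * p μ x ≤
        exp (l * DD θ ψ μ b) * ((1 - l) * p μ x + l * p b x) := by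
      intro x
      have hc := convexOn_exp.2 (Set.mem_univ (0:ℝ))
        (Set.mem_univ (dot u (φ x - μ) - DD θ ψ μ b)) (show 0 ≤ 1 - l by linarith) hlp.le (by ring)
      simp only [smul_eq_mul, mul_zero, zero_add, exp_zero, mul_one] at hc
      have hpp := ef_pos hF (hKM hμ) x
      have e1 : exp (dot u (φ x - μ) - DD θ ψ μ b) * p μ x = p b x := by
        have := ef_ratio hF (hKM hμ) hb x
        rw [exp_sub, div_mul_eq_mul_div, this, mul_div_cancel_left₀ _ (exp_pos _).ne']
      have e2 : exp (dot (l • u) (φ x - μ)) =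
          exp (l * DD θ ψ μ b) * exp (l * (dot u (φ x - μ) - DD θ ψ μ b)) := by
        rw [← exp_add, dot_smul_l]; congr 1; ring
      rw [e2, mul_assoc]
      refine mul_le_mul_of_nonneg_left ?_ (exp_pos _).le
      calc _ ≤ (1 - l + l * exp (dot u (φ x - μ) - DD θ ψ μ b)) * p μ x := by gcongr
        _ = (1 - l) * p μ x + l * (exp (dot u (φ x - μ) - DD θ ψ μ b) * p μ x) := by ring
        _ = _ := by rw [e1]
    have i0 : Integrable (fun x => exp (l * DD θ ψ μ b) * ((1 - l) * p μ x + l * p b x)) ν :=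
      (((ef_int hF (hKM hμ)).const_mul _).add ((ef_int hF hb).const_mul _)).const_mul _
    have i1 : Integrable (fun x => exp (dot (l • u) (φ x - μ)) * p μ x) ν := by
      refine i0.mono' ((Real.measurable_exp.comp (ef_dot_meas hF _ _)).mul
        (hF.p_meas μ)).aestronglyMeasurable (Filter.Eventually.of_forall fun x => ?_)
      rw [Real.norm_eq_abs, abs_of_pos (mul_pos (exp_pos _) (ef_pos hF (hKM hμ) x))]
      exact hpt x
    have hnl : ‖l • u‖ = 1 := by
      rw [norm_smul, Real.norm_eq_abs, abs_of_pos hlp, hl, inv_mul_cancel₀ hup.ne']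
    have h1 := key μ hμ (l • u) hnl.le i1
    have h2 := integral_mono i1 i0 hpt
    rw [integral_const_mul, integral_add ((ef_int hF (hKM hμ)).const_mul _)
      ((ef_int hF hb).const_mul _), integral_const_mul, integral_const_mul, hF.p_prob _ (hKM hμ),
      hF.p_prob _ hb] at h2
    rw [hnl] at h1
    have h3 : 1 + q' ≤ exp (l * DD θ ψ μ b) := by
      have : exp (l * DD θ ψ μ b) * ((1 - l) * 1 + l * 1) = exp (l * DD θ ψ μ b) := by ring
      rw [this] at h2
      nlinarith
    have h4 : Real.log (1 + q') ≤ l * DD θ ψ μ b := by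
      rw [Real.log_le_iff_le_exp (by positivity)]; exact h3
    calc _ ≤ Real.log (1 + q') * ‖u‖ := by gcongr; exact min_le_right _ _
      _ ≤ (l * DD θ ψ μ b) * ‖u‖ := by gcongr
      _ = DD θ ψ μ b * (l * ‖u‖) := by ring
      _ = _ := by rw [hl, inv_mul_cancel₀ hup.ne', mul_one]

lemma ef_lip (hF : IsMeanValueExpFam ν M p θ φ ψ r) {K : Set (Fin m → ℝ)} (hK : IsCompact K)
    (hKM : K ⊆ M) (hKn : K.Nonempty) : ∃ L > 0, ∃ ρ > 0, ∀ μ ∈ K, ∀ b ∈ M,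
      ‖b - μ‖ ≤ ρ → ‖θ b - θ μ‖ ≤ L * ‖b - μ‖ := by
  obtain ⟨c, hc, hS⟩ := ef_strong hF hK hKM hKn
  refine ⟨(m + 1) / c, by positivity, c / (2 * (m + 1)), by positivity, fun μ hμ b hb hbm => ?_⟩
  have h1 := hS μ hμ b hb
  have h2 := DD_le hF (hKM hμ) hb
  have h3 := dot_le (θ b - θ μ) (b - μ)
  set U := ‖θ b - θ μ‖
  set V := ‖b - μ‖
  have hU : 0 ≤ U := norm_nonneg _
  have hV : 0 ≤ V := norm_nonneg _
  have h4 : c * min (U ^ 2) U ≤ (m + 1) * U * V := by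
    have : 0 ≤ U * V := by positivity
    nlinarith
  rw [le_div_iff₀ (by positivity)] at hbm
  rw [div_mul_eq_mul_div, le_div_iff₀ hc]
  rcases hU.eq_or_lt with h0 | h0
  · rw [← h0]; simp; positivity
  rcases le_total (U ^ 2) U with h | h
  · rw [min_eq_left h] at h4
    have : U * (c * U) ≤ U * ((m + 1) * V) := by nlinarith
    have := le_of_mul_le_mul_left this h0
    linarith
  · rw [min_eq_right h] at h4
    have : U * c ≤ U * ((m + 1) * V) := by nlinarith
    have := le_of_mul_le_mul_left this h0
    nlinarith

lemma ef_θ_cont (hF : IsMeanValueExpFam ν M p θ φ ψ r) : ContinuousOn θ M := by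
  intro μ hμ
  obtain ⟨L, hL, ρ, hρ, h⟩ := ef_lip hF (isCompact_singleton (x := μ)) (by simpa using hμ)
    (Set.singleton_nonempty μ)
  rw [Metric.continuousWithinAt_iff]
  intro ε hε
  refine ⟨min ρ (ε / L), by positivity, fun b hb hd => ?_⟩
  rw [dist_eq_norm] at *
  have h1 := h μ rfl b hb (hd.le.trans (min_le_left _ _))
  have h2 := hd.trans_le (min_le_right _ _)
  rw [lt_div_iff₀ hL] at h2
  linarith

lemma ef_ψ_cont (hF : IsMeanValueExpFam ν M p θ φ ψ r) : ContinuousOn (fun μ => ψ (θ μ)) M := by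
  have h : (fun μ => ψ (θ μ)) = fun μ => dot (θ μ) μ - As θ ψ μ := by
    funext μ; simp [As]
  rw [h]
  exact (continuous_dot.comp_continuousOn ((ef_θ_cont hF).prodMk continuousOn_id)).sub (As_cont hF)

lemma ef_θ_inj (hF : IsMeanValueExpFam ν M p θ φ ψ r) {μ b} (hμ : μ ∈ M) (hb : b ∈ M)
    (h : θ μ = θ b) : μ = b := by
  funext i
  rw [← hF.mean_eq μ hμ i, ← hF.mean_eq b hb i]
  congr 1
  funext x
  rw [hF.p_form μ hμ, hF.p_form b hb, h]

lemma ef_mono_pos (hF : IsMeanValueExpFam ν M p θ φ ψ r) {μ b} (hμ : μ ∈ M) (hb : b ∈ M)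
    (h : μ ≠ b) : 0 < dot (θ b - θ μ) (b - μ) := by
  obtain ⟨c, hc, hS⟩ := ef_strong hF (isCompact_singleton (x := μ)) (by simpa using hμ)
    (Set.singleton_nonempty μ)
  have h1 := hS μ rfl b hb
  have h2 := DD_le hF hμ hb
  have : 0 < ‖θ b - θ μ‖ := by
    rw [norm_pos_iff, sub_ne_zero]
    exact fun h' => h (ef_θ_inj hF hμ hb h'.symm)
  have : 0 < c * min (‖θ b - θ μ‖ ^ 2) (‖θ b - θ μ‖) := by positivity
  linarith

end expfam3
end SwitchPaper
namespace SwitchPaper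
section expfam4
variable {𝒳 : Type*} [MeasurableSpace 𝒳] {m : ℕ} {ν : Measure 𝒳} {M : Set (Fin m → ℝ)}
  {p : (Fin m → ℝ) → 𝒳 → ℝ} {θ : (Fin m → ℝ) → (Fin m → ℝ)}
  {φ : 𝒳 → (Fin m → ℝ)} {ψ : (Fin m → ℝ) → ℝ} {r : 𝒳 → ℝ}

/-- extended mgf -/
def mg (ν : Measure 𝒳) (p : (Fin m → ℝ) → 𝒳 → ℝ) (φ : 𝒳 → (Fin m → ℝ)) (μ h : Fin m → ℝ) : ℝ≥0∞ :=
  ∫⁻ x, ENNReal.ofReal (exp (dot h (φ x - μ)) * p μ x) ∂ν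

lemma mg_meas (hF : IsMeanValueExpFam ν M p θ φ ψ r) (μ h : Fin m → ℝ) :
    Measurable fun x => exp (dot h (φ x - μ)) * p μ x :=
  (Real.measurable_exp.comp (ef_dot_meas hF _ _)).mul (hF.p_meas μ)

lemma mg_closed (hF : IsMeanValueExpFam ν M p θ φ ψ r) (μ : Fin m → ℝ) (C : ℝ≥0∞) :
    IsClosed {h | mg ν p φ μ h ≤ C} := by
  apply IsSeqClosed.isClosed
  intro u h hu hlim
  have h1 : ∀ x, Filter.Tendsto (fun n => ENNReal.ofReal (exp (dot (u n) (φ x - μ)) * p μ x))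
      Filter.atTop (nhds (ENNReal.ofReal (exp (dot h (φ x - μ)) * p μ x))) := by
    intro x
    have hc : Continuous fun h : Fin m → ℝ => ENNReal.ofReal (exp (dot h (φ x - μ)) * p μ x) := by
      have : Continuous fun h : Fin m → ℝ => dot h (φ x - μ) := by unfold dot; fun_prop
      exact ENNReal.continuous_ofReal.comp ((Real.continuous_exp.comp this).mul continuous_const)
    exact (hc.tendsto h).comp hlim
  show mg ν p φ μ h ≤ C
  calc mg ν p φ μ h = ∫⁻ x, Filter.liminf
        (fun n => ENNReal.ofReal (exp (dot (u n) (φ x - μ)) * p μ x)) Filter.atTop ∂ν := by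
        unfold mg
        congr 1
        funext x
        rw [(h1 x).liminf_eq]
    _ ≤ Filter.liminf (fun n => mg ν p φ μ (u n)) Filter.atTop :=
        lintegral_liminf_le fun n => (mg_meas hF μ (u n)).ennreal_ofReal
    _ ≤ Filter.liminf (fun _ : ℕ => C) Filter.atTop :=
        Filter.liminf_le_liminf (Filter.Eventually.of_forall fun n => hu n)
    _ = C := Filter.liminf_const C

lemma mg_convex (hF : IsMeanValueExpFam ν M p θ φ ψ r) {μ : Fin m → ℝ} (hμ : μ ∈ M) (C : ℝ≥0∞) :
    Convex ℝ {h | mg ν p φ μ h ≤ C} := by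
  intro h1 H1 h2 H2 a b ha hb hab
  show mg ν p φ μ _ ≤ C
  have hpt : ∀ x, ENNReal.ofReal (exp (dot (a • h1 + b • h2) (φ x - μ)) * p μ x) ≤
      ENNReal.ofReal a * ENNReal.ofReal (exp (dot h1 (φ x - μ)) * p μ x) +
      ENNReal.ofReal b * ENNReal.ofReal (exp (dot h2 (φ x - μ)) * p μ x) := by
    intro x
    have hp := (ef_pos hF hμ x).le
    rw [← ENNReal.ofReal_mul ha, ← ENNReal.ofReal_mul hb,
      ← ENNReal.ofReal_add (by positivity) (by positivity)]
    apply ENNReal.ofReal_le_ofReal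
    have hc := convexOn_exp.2 (Set.mem_univ (dot h1 (φ x - μ)))
        (Set.mem_univ (dot h2 (φ x - μ))) ha hb hab
    simp only [smul_eq_mul] at hc
    rw [dot_add_l, dot_smul_l, dot_smul_l]
    nlinarith
  calc mg ν p φ μ (a • h1 + b • h2) ≤ ∫⁻ x,
      (ENNReal.ofReal a * ENNReal.ofReal (exp (dot h1 (φ x - μ)) * p μ x) +
      ENNReal.ofReal b * ENNReal.ofReal (exp (dot h2 (φ x - μ)) * p μ x)) ∂ν := lintegral_mono hpt
    _ = ENNReal.ofReal a * mg ν p φ μ h1 + ENNReal.ofReal b * mg ν p φ μ h2 := by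
        rw [lintegral_add_left ((mg_meas hF μ h1).ennreal_ofReal.const_mul _),
          lintegral_const_mul _ (mg_meas hF μ h1).ennreal_ofReal,
          lintegral_const_mul _ (mg_meas hF μ h2).ennreal_ofReal]
        rfl
    _ ≤ ENNReal.ofReal a * C + ENNReal.ofReal b * C := by
        gcongr
        · exact H1
        · exact H2
    _ = C := by rw [← add_mul, ← ENNReal.ofReal_add ha hb, hab]; simp

lemma ef_expmom (hF : IsMeanValueExpFam ν M p θ φ ψ r) (hm : 0 < m) {K : Set (Fin m → ℝ)}
    (hK : IsCompact K) (hKM : K ⊆ M) (hKn : K.Nonempty) :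
    ∃ r0 > 0, ∃ C > 0, ∀ μ ∈ K, ∀ h : Fin m → ℝ, ‖h‖ ≤ r0 →
      mg ν p φ μ h ≤ ENNReal.ofReal C := by
  obtain ⟨ρ, hρ, hsub⟩ := hK.exists_cthickening_subset_open (ef_isOpen hF) hKM
  have hKc := hK.cthickening (r := ρ)
  have hmem : ∀ μ ∈ K, ∀ v : Fin m → ℝ, ‖v‖ ≤ ρ → μ + v ∈ Metric.cthickening ρ K := by
    intro μ hμ v hv
    exact Metric.mem_cthickening_of_dist_le _ μ _ _ hμ (by simpa [dist_eq_norm] using hv)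
  obtain ⟨B, hB, hBK⟩ := ef_bdd hF hKc hsub
  have : Nonempty (Fin m) := ⟨⟨0, hm⟩⟩
  have hsn : (Metric.sphere (0 : Fin m → ℝ) ρ).Nonempty := NormedSpace.sphere_nonempty.2 hρ.le
  have hcont : ContinuousOn (fun z : (Fin m → ℝ) × (Fin m → ℝ) =>
      dot (θ (z.1 + z.2) - θ z.1) z.2) (K ×ˢ Metric.sphere 0 ρ) := by
    have c1 : ContinuousOn (fun z : (Fin m → ℝ) × (Fin m → ℝ) => θ (z.1 + z.2))
        (K ×ˢ Metric.sphere 0 ρ) := by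
      refine (ef_θ_cont hF).comp (by fun_prop) ?_
      rintro ⟨μ, v⟩ ⟨h1, h2⟩
      exact hsub (hmem μ h1 v (by simpa using h2.le))
    have c2 : ContinuousOn (fun z : (Fin m → ℝ) × (Fin m → ℝ) => θ z.1)
        (K ×ˢ Metric.sphere 0 ρ) := by
      refine (ef_θ_cont hF).comp (by fun_prop) ?_
      rintro ⟨μ, v⟩ ⟨h1, h2⟩
      exact hKM h1
    exact continuous_dot.comp_continuousOn ((c1.sub c2).prodMk continuousOn_snd)
  obtain ⟨z0, ⟨hz1, hz2⟩, hmin⟩ := (hK.prod (isCompact_sphere (0 : Fin m → ℝ) ρ)).exists_isMinOn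
    (hKn.prod hsn) hcont
  set c := dot (θ (z0.1 + z0.2) - θ z0.1) z0.2 with hc
  have hc0 : 0 < c := by
    have hn : ‖z0.2‖ = ρ := by simpa using hz2
    have h1 : z0.1 + z0.2 ∈ M := hsub (hmem _ hz1 _ hn.le)
    have := ef_mono_pos hF (hKM hz1) h1 (by
      intro h
      have : z0.2 = 0 := by simpa using h
      rw [this] at hn; simp at hn; linarith)
    simpa using this
  refine ⟨c / (ρ * m), by positivity, exp (m * (2 * B) * ρ), exp_pos _, fun μ hμ h hh => ?_⟩
  by_contra hcon
  obtain ⟨f, t, hf1, hf2⟩ := geometric_hahn_banach_closed_point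
    (mg_convex hF (hKM hμ) (ENNReal.ofReal (exp (m * (2 * B) * ρ))))
    (mg_closed hF μ (ENNReal.ofReal (exp (m * (2 * B) * ρ)))) hcon
  set w : Fin m → ℝ := fun j => f (Pi.single j 1) with hw
  have hfw : ∀ x, f x = dot x w := by
    intro x
    have : x = ∑ j, x j • (Pi.single j 1 : Fin m → ℝ) := by
      funext i; simp [Finset.sum_apply, Pi.single_apply]
    conv_lhs => rw [this]
    simp [dot, hw]
  have hin : ∀ v : Fin m → ℝ, ‖v‖ = ρ → mg ν p φ μ (θ (μ + v) - θ μ) ≤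
      ENNReal.ofReal (exp (m * (2 * B) * ρ)) := by
    intro v hv
    have hv1 := hmem μ hμ v hv.le
    obtain ⟨g1, g2⟩ := ef_mgf hF (hKM hμ) (hsub hv1)
    rw [mg, ← ofReal_integral_eq_lintegral_ofReal g1 (Filter.Eventually.of_forall fun x =>
      (mul_pos (exp_pos _) (ef_pos hF (hKM hμ) x)).le), g2]
    apply ENNReal.ofReal_le_ofReal
    apply exp_le_exp.2
    have h1 := DD_le hF (hKM hμ) (hsub hv1)
    rw [add_sub_cancel_left] at h1
    refine (h1.trans (dot_le _ _)).trans ?_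
    rw [hv]
    have h2 : ‖θ (μ + v) - θ μ‖ ≤ 2 * B := by
      refine (norm_sub_le _ _).trans ?_
      have := (hBK _ hv1).1
      have := (hBK μ (Metric.self_subset_cthickening K hμ)).1
      linarith
    gcongr
  have hw0 : w ≠ 0 := by
    intro h0
    obtain ⟨v, hv⟩ := hsn
    have := hf1 _ (hin v (by simpa using hv))
    rw [hfw, h0, dot_comm, dot_zero_l] at this
    rw [hfw, h0, dot_comm, dot_zero_l] at hf2
    linarith
  have hwn : 0 < ‖w‖ := norm_pos_iff.2 hw0
  set v := (ρ / ‖w‖) • w with hv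
  have hvn : ‖v‖ = ρ := by
    rw [hv, norm_smul, Real.norm_eq_abs, abs_of_pos (by positivity)]; field_simp
  have h1 := (hf1 _ (hin v hvn)).trans hf2
  rw [hfw, hfw] at h1
  have h2 : c ≤ dot (θ (μ + v) - θ μ) v :=
    hmin (show (μ, v) ∈ K ×ˢ Metric.sphere 0 ρ from ⟨hμ, by simpa using hvn⟩)
  rw [hv, dot_smul_r, ← hv] at h2
  have h3 := dot_le h w
  have h4 : ρ / ‖w‖ * dot (θ (μ + v) - θ μ) w < ρ / ‖w‖ * (m * ‖h‖ * ‖w‖) :=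
    mul_lt_mul_of_pos_left (h1.trans_le h3) (by positivity)
  have h5 : ρ / ‖w‖ * (m * ‖h‖ * ‖w‖) = ‖h‖ * (ρ * m) := by field_simp
  rw [le_div_iff₀ (by positivity)] at hh
  linarith

lemma mg_integrable (hF : IsMeanValueExpFam ν M p θ φ ψ r) {μ : Fin m → ℝ} (hμ : μ ∈ M)
    {h : Fin m → ℝ} {C : ℝ} (hC : 0 ≤ C) (hh : mg ν p φ μ h ≤ ENNReal.ofReal C) :
    Integrable (fun x => exp (dot h (φ x - μ)) * p μ x) ν ∧
      ∫ x, exp (dot h (φ x - μ)) * p μ x ∂ν ≤ C := by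
  have hnn : 0 ≤ᵐ[ν] fun x => exp (dot h (φ x - μ)) * p μ x :=
    Filter.Eventually.of_forall fun x => (mul_pos (exp_pos _) (ef_pos hF hμ x)).le
  have hi : Integrable (fun x => exp (dot h (φ x - μ)) * p μ x) ν := by
    refine ⟨(mg_meas hF μ h).aestronglyMeasurable, ?_⟩
    rw [hasFiniteIntegral_iff_ofReal hnn]
    exact hh.trans_lt ENNReal.ofReal_lt_top
  refine ⟨hi, ?_⟩
  rw [integral_eq_lintegral_of_nonneg_ae hnn (mg_meas hF μ h).aestronglyMeasurable]
  exact ENNReal.toReal_le_of_le_ofReal hC hh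

/-- Uniform sub-Gaussian bound near zero. -/
lemma ef_smooth (hF : IsMeanValueExpFam ν M p θ φ ψ r) (hm : 0 < m) {K : Set (Fin m → ℝ)}
    (hK : IsCompact K) (hKM : K ⊆ M) (hKn : K.Nonempty) :
    ∃ r0 > 0, ∃ C > 0, ∀ μ ∈ K, ∀ h : Fin m → ℝ, ‖h‖ ≤ r0 →
      Integrable (fun x => exp (dot h (φ x - μ)) * p μ x) ν ∧
      ∫ x, exp (dot h (φ x - μ)) * p μ x ∂ν ≤ exp (C * ‖h‖ ^ 2) := by
  obtain ⟨r0, hr0, C, hC, hmg⟩ := ef_expmom hF hm hK hKM hKn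
  refine ⟨r0 / 2, by positivity, 16 * C / r0 ^ 2, by positivity, fun μ hμ h hh => ?_⟩
  have hi := (mg_integrable hF (hKM hμ) hC.le (hmg μ hμ h (by linarith))).1
  refine ⟨hi, ?_⟩
  by_cases h0 : h = 0
  · rw [h0]; simp [dot_zero_l, hF.p_prob μ (hKM hμ)]
  have hn : 0 < ‖h‖ := norm_pos_iff.2 h0
  set s := ‖h‖ / r0 with hs
  have hs0 : 0 < s := by positivity
  have hs1 : s ≤ 1 / 2 := by rw [hs, div_le_iff₀ hr0]; linarith
  set h' := s⁻¹ • h with hh'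
  have hsh : h = s • h' := by rw [hh', smul_inv_smul₀ hs0.ne']
  have hn' : ‖h'‖ = r0 := by
    rw [hh', norm_smul, norm_inv, Real.norm_eq_abs, abs_of_pos hs0, hs]; field_simp
  obtain ⟨j1, j2⟩ := mg_integrable hF (hKM hμ) hC.le (hmg μ hμ h' hn'.le)
  obtain ⟨k1, k2⟩ := mg_integrable hF (hKM hμ) hC.le (hmg μ hμ (-h') (by rw [norm_neg, hn']))
  obtain ⟨d1, d2⟩ := ef_dot_int hF (hKM hμ) h μ
  have i3 := ef_int hF (hKM hμ)
  have hneg : ∀ x, dot (-h') (φ x - μ) = - dot h' (φ x - μ) := by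
    intro x; simp [dot]
  have hpt : ∀ x, exp (dot h (φ x - μ)) * p μ x ≤
      (p μ x + dot h (φ x - μ) * p μ x) + 8 * s ^ 2 * (exp (dot h' (φ x - μ)) * p μ x +
        exp (dot (-h') (φ x - μ)) * p μ x) := by
    intro x
    have hp := ef_pos hF (hKM hμ) x
    have e1 := exp_upper (dot h (φ x - μ))
    rw [hneg]
    set y := dot h' (φ x - μ) with hy
    have e2 : dot h (φ x - μ) = s * y := by rw [hsh, dot_smul_l]
    rw [e2] at e1 ⊢
    have e3 : exp |y| ≤ exp y + exp (-y) := by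
      rcases abs_cases y with ⟨h, _⟩ | ⟨h, _⟩ <;> rw [h]
      · linarith [exp_pos (-y)]
      · linarith [exp_pos y]
    have e4 : (s * y) ^ 2 * exp |s * y| ≤ 8 * s ^ 2 * exp |y| := by
      have a1 : exp |s * y| ≤ exp (|y| / 2) := by
        apply exp_le_exp.2
        rw [abs_mul, abs_of_pos hs0]
        nlinarith [abs_nonneg y]
      have a2 : y ^ 2 ≤ 8 * exp (|y| / 2) := by
        have := Real.quadratic_le_exp_of_nonneg (x := |y| / 2) (by positivity)
        rw [← sq_abs]
        nlinarith [abs_nonneg y]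
      have a3 : exp |y| = exp (|y| / 2) * exp (|y| / 2) := by rw [← exp_add]; congr 1; ring
      rw [a3, mul_pow]
      calc s ^ 2 * y ^ 2 * exp |s * y| ≤ s ^ 2 * (8 * exp (|y| / 2)) * exp (|y| / 2) := by gcongr
        _ = _ := by ring
    have e5 : 8 * s ^ 2 * exp |y| ≤ 8 * s ^ 2 * (exp y + exp (-y)) := by gcongr
    have e6 : exp (s * y) ≤ 1 + s * y + 8 * s ^ 2 * (exp y + exp (-y)) := by linarith
    calc _ ≤ (1 + s * y + 8 * s ^ 2 * (exp y + exp (-y))) * p μ x := by gcongr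
      _ = _ := by ring
  have l1 : Integrable (fun x => p μ x + dot h (φ x - μ) * p μ x) ν := i3.add d1
  have l2 : Integrable (fun x => 8 * s ^ 2 * (exp (dot h' (φ x - μ)) * p μ x +
        exp (dot (-h') (φ x - μ)) * p μ x)) ν := (j1.add k1).const_mul _
  have l3 := integral_mono hi (l1.add l2) hpt
  have l4 : ∫ x, ((p μ x + dot h (φ x - μ) * p μ x) + 8 * s ^ 2 * (exp (dot h' (φ x - μ)) * p μ x +
        exp (dot (-h') (φ x - μ)) * p μ x)) ∂ν ≤ 1 + 8 * s ^ 2 * (C + C) := by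
    rw [integral_add l1 l2, integral_add i3 d1, d2, hF.p_prob μ (hKM hμ), integral_const_mul,
      integral_add j1 k1]
    have : dot h (μ - μ) = 0 := by simp [dot]
    rw [this, add_zero]
    gcongr
  refine l3.trans (l4.trans ?_)
  have : 8 * s ^ 2 * (C + C) = 16 * C / r0 ^ 2 * ‖h‖ ^ 2 := by rw [hs]; field_simp; ring
  rw [this]
  linarith [Real.add_one_le_exp (16 * C / r0 ^ 2 * ‖h‖ ^ 2)]

lemma ef_sep (hF : IsMeanValueExpFam ν M p θ φ ψ r) (hm : 0 < m) {K : Set (Fin m → ℝ)}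
    (hK : IsCompact K) (hKM : K ⊆ M) (hKn : K.Nonempty) :
    ∃ c > 0, ∀ μ ∈ K, ∀ t ∈ M, c * min ‖t - μ‖ 1 ≤ ‖θ t - θ μ‖ := by
  obtain ⟨r0, hr0, C, hC, hS⟩ := ef_smooth hF hm hK hKM hKn
  have hm' : (0:ℝ) < m := by exact_mod_cast hm
  refine ⟨min (1 / (4 * C)) (r0 / 2) / m, by positivity, fun μ hμ t ht => ?_⟩
  by_cases htm : t = μ
  · rw [htm]; simp
  set V := ‖t - μ‖ with hV
  have hVp : 0 < V := norm_pos_iff.2 (sub_ne_zero.2 htm)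
  set u := θ t - θ μ with hu
  -- step size
  have key : ∀ s : ℝ, 0 < s → s * V ≤ r0 → s * dot (t - μ) (t - μ) - dot u (t - μ) ≤ C * (s * V) ^ 2 := by
    intro s hs hsV
    have hn : ‖s • (t - μ)‖ = s * V := by rw [norm_smul, Real.norm_eq_abs, abs_of_pos hs]
    obtain ⟨i1, i2⟩ := hS μ hμ (s • (t - μ)) (by rw [hn]; exact hsV)
    set h := s • (t - μ) with hh
    have e : ∀ x, exp (dot h (φ x - μ)) * p μ x =
        exp (dot (h - u) (t - μ) + DD θ ψ μ t) * (exp (dot (h - u) (φ x - t)) * p t x) := by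
      intro x
      rw [hF.p_form μ (hKM hμ), hF.p_form t ht, ← mul_assoc, ← mul_assoc, ← mul_assoc, ← exp_add,
        ← exp_add, ← exp_add]
      congr 2
      simp only [DD, hu, dot_sub_l, dot_sub_r]; ring
    have i3 : Integrable (fun x => exp (dot (h - u) (φ x - t)) * p t x) ν := by
      have := i1.const_mul (exp (dot (h - u) (t - μ) + DD θ ψ μ t))⁻¹
      refine this.congr (Filter.Eventually.of_forall fun x => ?_)
      simp only
      rw [e, inv_mul_cancel_left₀ (exp_pos _).ne']
    have i4 := ef_jensen hF ht _ i3
    have i5 : exp (dot (h - u) (t - μ) + DD θ ψ μ t) ≤ exp (C * ‖h‖ ^ 2) := by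
      refine le_trans ?_ i2
      simp only [e]
      rw [integral_const_mul]
      exact le_mul_of_one_le_right (exp_pos _).le i4
    rw [exp_le_exp, hn, dot_sub_l, hh, dot_smul_l] at i5
    have := DD_nonneg hF (hKM hμ) ht
    linarith
  have h1 := norm_sq_le_dot (t - μ)
  have h2 := dot_le u (t - μ)
  rw [← hV] at h1 h2
  -- s := min (1/(2C)) (r0/V)
  set s := min (1 / (2 * C)) (r0 / V) with hs
  have hs0 : 0 < s := by positivity
  have h3 := key s hs0 (by
    calc s * V ≤ r0 / V * V := by gcongr; exact min_le_right _ _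
      _ = r0 := by field_simp)
  have h4 : C * s ≤ 1 / 2 := by
    calc C * s ≤ C * (1 / (2 * C)) := by gcongr; exact min_le_left _ _
      _ = 1 / 2 := by field_simp
  have h5 : s * V ^ 2 / 2 ≤ m * ‖u‖ * V := by
    have a1 : s * V ^ 2 ≤ s * dot (t - μ) (t - μ) := by gcongr
    have a2 : C * (s * V) ^ 2 ≤ 1 / 2 * (s * V ^ 2) := by
      calc C * (s * V) ^ 2 = (C * s) * (s * V ^ 2) := by ring
        _ ≤ _ := by gcongr
    linarith
  have h6 : s * V / 2 ≤ m * ‖u‖ := by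
    have : V * (s * V / 2) ≤ V * (m * ‖u‖) := by nlinarith
    exact le_of_mul_le_mul_left this hVp
  rw [div_mul_eq_mul_div, div_le_iff₀ hm', mul_comm ‖u‖]
  refine le_trans ?_ h6
  rcases le_total (1 / (2 * C)) (r0 / V) with h7 | h7
  · rw [hs, min_eq_left h7]
    calc min (1 / (4 * C)) (r0 / 2) * min V 1 ≤ 1 / (4 * C) * V := by
          gcongr
          · exact min_le_left _ _
          · exact min_le_left _ _
      _ = _ := by field_simp; norm_num
  · rw [hs, min_eq_right h7]
    calc min (1 / (4 * C)) (r0 / 2) * min V 1 ≤ r0 / 2 * 1 := by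
          gcongr
          · exact min_le_right _ _
          · exact min_le_right _ _
      _ = _ := by field_simp

end expfam4
end SwitchPaper
namespace SwitchPaper
section expfam5
variable {𝒳 : Type*} [MeasurableSpace 𝒳] {m : ℕ} {ν : Measure 𝒳} {M : Set (Fin m → ℝ)}
  {p : (Fin m → ℝ) → 𝒳 → ℝ} {θ : (Fin m → ℝ) → (Fin m → ℝ)}
  {φ : 𝒳 → (Fin m → ℝ)} {ψ : (Fin m → ℝ) → ℝ} {r : 𝒳 → ℝ}

lemma ef_far (hF : IsMeanValueExpFam ν M p θ φ ψ r) (hm : 0 < m) {K : Set (Fin m → ℝ)}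
    (hK : IsCompact K) (hKM : K ⊆ M) (hKn : K.Nonempty) {Dm : ℝ} (hDm : 0 < Dm) :
    ∃ ε > 0, ε ≤ 1 ∧ ∃ c > 0, ∀ μ ∈ K, ∀ t ∈ M, ∀ δ : ℝ, 0 ≤ δ → δ ≤ Dm → δ ≤ ‖t - μ‖ →
      ∀ a : Fin m → ℝ, ‖a - μ‖ ≤ ε * δ →
        c * δ ^ 2 ≤ DD θ ψ μ t - dot (θ t - θ μ) (a - μ) := by
  obtain ⟨cS, hcS, hS⟩ := ef_strong hF hK hKM hKn
  obtain ⟨cs, hcs, hs⟩ := ef_sep hF hm hK hKM hKn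
  have hm' : (0:ℝ) < m := by exact_mod_cast hm
  set k := cs / (Dm + 1) with hk
  have hk0 : 0 < k := by positivity
  set ε := min 1 (cS / 2 / (m * (1 / k + Dm))) with hε
  have hε0 : 0 < ε := by positivity
  have hε1 : ε * (m * (1 / k + Dm)) ≤ cS / 2 := by
    calc _ ≤ (cS / 2 / (m * (1 / k + Dm))) * (m * (1 / k + Dm)) := by
          gcongr; exact min_le_right _ _
      _ = _ := by field_simp
  have hεa : m * ε * (1 / k) ≤ cS / 2 := by
    have : 0 ≤ ε * m * Dm := by positivity
    nlinarith
  have hεb : m * ε * Dm ≤ cS / 2 := by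
    have : 0 ≤ ε * m * (1 / k) := by positivity
    nlinarith
  refine ⟨ε, hε0, min_le_left _ _, min (cS * k ^ 2 / 2) (cS / (2 * (Dm ^ 2 + 1))), by positivity,
    fun μ hμ t ht δ hδ hδD hδt a ha => ?_⟩
  have h1 := hS μ hμ t ht
  have h2 := hs μ hμ t ht
  have h3 := dot_le (θ t - θ μ) (a - μ)
  set U := ‖θ t - θ μ‖ with hU
  have hU0 : 0 ≤ U := norm_nonneg _
  have h4 : k * δ ≤ U := by
    refine le_trans ?_ h2
    rw [hk, div_mul_eq_mul_div, div_le_iff₀ (by positivity), mul_assoc]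
    refine mul_le_mul_of_nonneg_left ?_ hcs.le
    rcases le_total ‖t - μ‖ 1 with h | h
    · rw [min_eq_left h]; nlinarith
    · rw [min_eq_right h]; linarith
  have h5 : dot (θ t - θ μ) (a - μ) ≤ m * U * (ε * δ) := h3.trans (by gcongr)
  have hδU : δ ≤ U * (1 / k) := by rw [mul_one_div, le_div_iff₀ hk0]; linarith
  rcases le_total (U ^ 2) U with h | h
  · rw [min_eq_left h] at h1
    have h6 : m * U * (ε * δ) ≤ cS / 2 * U ^ 2 := by
      calc m * U * (ε * δ) ≤ m * U * (ε * (U * (1 / k))) := by gcongr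
        _ = (m * ε * (1 / k)) * U ^ 2 := by ring
        _ ≤ _ := by gcongr
    have h7 : (k * δ) ^ 2 ≤ U ^ 2 := by gcongr
    have h8 : min (cS * k ^ 2 / 2) (cS / (2 * (Dm ^ 2 + 1))) * δ ^ 2 ≤ cS * k ^ 2 / 2 * δ ^ 2 := by
      gcongr; exact min_le_left _ _
    nlinarith
  · rw [min_eq_right h] at h1
    have h6 : m * U * (ε * δ) ≤ cS / 2 * U := by
      calc m * U * (ε * δ) ≤ m * U * (ε * Dm) := by gcongr
        _ = (m * ε * Dm) * U := by ring
        _ ≤ _ := by gcongr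
    rcases hU0.eq_or_lt with hz | hz
    · have : δ = 0 := by
        rw [← hz] at hδU; linarith
      rw [this]
      nlinarith
    have hU1 : 1 ≤ U := by nlinarith
    have h8 : min (cS * k ^ 2 / 2) (cS / (2 * (Dm ^ 2 + 1))) * δ ^ 2 ≤
        cS / (2 * (Dm ^ 2 + 1)) * (Dm ^ 2 + 1) := by
      gcongr
      · exact min_le_right _ _
      · nlinarith
    have h9 : cS / (2 * (Dm ^ 2 + 1)) * (Dm ^ 2 + 1) = cS / 2 := by field_simp
    nlinarith

lemma ef_near (hF : IsMeanValueExpFam ν M p θ φ ψ r) {K : Set (Fin m → ℝ)}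
    (hK : IsCompact K) (hKM : K ⊆ M) (hKn : K.Nonempty) {Dm η : ℝ} (hDm : 0 < Dm) (hη : 0 < η)
    {ρ1 : ℝ} (hρ1 : 0 < ρ1) :
    ∃ ρ > 0, ρ * Dm ≤ ρ1 ∧ ∀ μ ∈ K, ∀ b ∈ M, ∀ δ : ℝ, 0 ≤ δ → δ ≤ Dm → ‖b - μ‖ ≤ ρ * δ →
      ∀ a : Fin m → ℝ, ‖a - μ‖ ≤ δ →
        DD θ ψ μ b - dot (θ b - θ μ) (a - μ) ≤ η * δ ^ 2 := by
  obtain ⟨L, hL, ρ0, hρ0, hlip⟩ := ef_lip hF hK hKM hKn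
  set ρ := min (min 1 (ρ0 / Dm)) (min (ρ1 / Dm) (η / (2 * L * (m + 1)))) with hρ
  have hp : 0 < ρ := by positivity
  have b1 : ρ ≤ 1 := (min_le_left _ _).trans (min_le_left _ _)
  have b2 : ρ * Dm ≤ ρ0 := by
    rw [← le_div_iff₀ hDm]; exact (min_le_left _ _).trans (min_le_right _ _)
  have b3 : ρ * Dm ≤ ρ1 := by
    rw [← le_div_iff₀ hDm]; exact (min_le_right _ _).trans (min_le_left _ _)
  have b4 : ρ * (2 * L * (m + 1)) ≤ η := by
    rw [← le_div_iff₀ (by positivity)]; exact (min_le_right _ _).trans (min_le_right _ _)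
  refine ⟨ρ, hp, b3, fun μ hμ b hb δ hδ hδD hbm a ha => ?_⟩
  have h1 := hlip μ hμ b hb (hbm.trans (le_trans (by gcongr) b2))
  have h2 := DD_le hF (hKM hμ) hb
  have h3 := dot_le (θ b - θ μ) (b - μ)
  have h4 := (abs_le.1 (abs_dot_le (θ b - θ μ) (a - μ))).1
  have h5 : ‖θ b - θ μ‖ ≤ L * (ρ * δ) := h1.trans (by gcongr)
  have h6 : (m:ℝ) * ‖θ b - θ μ‖ * ‖b - μ‖ ≤ (m + 1) * (L * (ρ * δ)) * (1 * δ) := by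
    gcongr
    · linarith
    · exact hbm.trans (by gcongr)
  have h7 : (m:ℝ) * ‖θ b - θ μ‖ * ‖a - μ‖ ≤ (m + 1) * (L * (ρ * δ)) * (1 * δ) := by
    gcongr
    · linarith
    · linarith
  have h8 : (ρ * (2 * L * (m + 1))) * δ ^ 2 ≤ η * δ ^ 2 := by gcongr
  nlinarith

lemma ef_lik (hF : IsMeanValueExpFam ν M p θ φ ψ r) {μ t : Fin m → ℝ} (hμ : μ ∈ M) (ht : t ∈ M)
    {n : ℕ} (hn : 0 < n) (xs : Fin n → 𝒳) :
    likelihood p t xs = exp (-(n * (DD θ ψ μ t - dot (θ t - θ μ) (mleRaw φ xs - μ)))) *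
      likelihood p μ xs := by
  have hn' : (n:ℝ) ≠ 0 := by exact_mod_cast hn.ne'
  have h1 : ∀ x, p t x = exp (dot (θ t - θ μ) (φ x - μ) - DD θ ψ μ t) * p μ x := by
    intro x
    rw [exp_sub, div_mul_eq_mul_div, ef_ratio hF hμ ht, mul_div_cancel_left₀ _ (exp_pos _).ne']
  unfold likelihood
  simp only [h1]
  rw [Finset.prod_mul_distrib, ← Real.exp_sum]
  congr 2
  rw [Finset.sum_sub_distrib]
  have : dot (θ t - θ μ) (mleRaw φ xs - μ) = (∑ i, dot (θ t - θ μ) (φ (xs i) - μ)) / n := by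
    simp only [dot_sub_r, Finset.sum_sub_distrib]
    rw [sub_div]
    congr 1
    · simp only [dot, mleRaw]
      rw [Finset.sum_comm, Finset.sum_div]
      refine Finset.sum_congr rfl fun j _ => ?_
      rw [← Finset.mul_sum, mul_div_assoc]
    · simp; field_simp
  rw [this]
  simp
  field_simp
  ring

lemma iid_le_one [SigmaFinite ν] (hF : IsMeanValueExpFam ν M p θ φ ψ r) {μ : Fin m → ℝ}
    (hμ : μ ∈ M) (n : ℕ) (A : Set (Fin n → 𝒳)) : iidLaw ν (p μ) n A ≤ 1 := by
  refine (measure_mono (Set.subset_univ A)).trans ?_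
  rw [iidLaw, withDensity_apply _ MeasurableSet.univ, Measure.restrict_univ,
    ← ofReal_integral_eq_lintegral_ofReal (Integrable.fintype_prod fun _ => ef_int hF hμ)
      (Filter.Eventually.of_forall fun xs => Finset.prod_nonneg fun i _ => (ef_pos hF hμ _).le),
    integral_fintype_prod_eq_prod (fun _ => p μ)]
  simp [hF.p_prob μ hμ]

lemma iid_chernoff [SigmaFinite ν] (hF : IsMeanValueExpFam ν M p θ φ ψ r) {μ : Fin m → ℝ}
    (hμ : μ ∈ M) (n : ℕ) (h : Fin m → ℝ) (T E : ℝ)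
    (hi : Integrable (fun x => exp (dot h (φ x - μ)) * p μ x) ν)
    (hE : ∫ x, exp (dot h (φ x - μ)) * p μ x ∂ν ≤ E) :
    iidLaw ν (p μ) n {xs | T ≤ ∑ i, dot h (φ (xs i) - μ)} ≤ ENNReal.ofReal (exp (-T) * E ^ n) := by
  have hA : MeasurableSet {xs : Fin n → 𝒳 | T ≤ ∑ i, dot h (φ (xs i) - μ)} := by
    refine measurableSet_le measurable_const (Finset.measurable_sum _ fun i _ => ?_)
    exact (ef_dot_meas hF h μ).comp (measurable_pi_apply i)
  rw [iidLaw, withDensity_apply _ hA]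
  calc ∫⁻ xs in {xs : Fin n → 𝒳 | T ≤ ∑ i, dot h (φ (xs i) - μ)},
        ENNReal.ofReal (∏ i, p μ (xs i)) ∂(Measure.pi fun _ : Fin n => ν)
      ≤ ∫⁻ xs in {xs : Fin n → 𝒳 | T ≤ ∑ i, dot h (φ (xs i) - μ)},
        ENNReal.ofReal (exp (-T) * ∏ i, (exp (dot h (φ (xs i) - μ)) * p μ (xs i)))
          ∂(Measure.pi fun _ : Fin n => ν) := by
        refine setLIntegral_mono' hA fun xs hxs => ENNReal.ofReal_le_ofReal ?_
        rw [Finset.prod_mul_distrib, ← Real.exp_sum, ← mul_assoc, ← exp_add]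
        refine le_mul_of_one_le_left (Finset.prod_nonneg fun i _ => (ef_pos hF hμ _).le) ?_
        rw [Real.one_le_exp_iff]
        have : T ≤ ∑ i, dot h (φ (xs i) - μ) := hxs
        linarith
    _ ≤ ∫⁻ xs, ENNReal.ofReal (exp (-T) * ∏ i, (exp (dot h (φ (xs i) - μ)) * p μ (xs i)))
          ∂(Measure.pi fun _ : Fin n => ν) := setLIntegral_le_lintegral _ _
    _ = ENNReal.ofReal (∫ xs, exp (-T) * ∏ i, (exp (dot h (φ (xs i) - μ)) * p μ (xs i))
          ∂(Measure.pi fun _ : Fin n => ν)) := by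
        rw [ofReal_integral_eq_lintegral_ofReal]
        · exact (Integrable.fintype_prod (f := fun _ x => exp (dot h (φ x - μ)) * p μ x)
            fun _ => hi).const_mul _
        · exact Filter.Eventually.of_forall fun xs => mul_nonneg (exp_pos _).le
            (Finset.prod_nonneg fun i _ => (mul_pos (exp_pos _) (ef_pos hF hμ _)).le)
    _ ≤ _ := by
        apply ENNReal.ofReal_le_ofReal
        rw [integral_const_mul,
          integral_fintype_prod_eq_prod (fun _ x => exp (dot h (φ x - μ)) * p μ x)]
        simp only [Finset.prod_const, Finset.card_univ, Fintype.card_fin]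
        gcongr
        exact integral_nonneg fun x => (mul_pos (exp_pos _) (ef_pos hF hμ _)).le

lemma iid_conc [SigmaFinite ν] (hF : IsMeanValueExpFam ν M p θ φ ψ r) (hm : 0 < m)
    {K : Set (Fin m → ℝ)} (hK : IsCompact K) (hKM : K ⊆ M) (hKn : K.Nonempty)
    {Dm ε : ℝ} (hDm : 0 < Dm) (hε : 0 < ε) :
    ∃ c > 0, ∀ μ ∈ K, ∀ δ : ℝ, 0 < δ → δ ≤ Dm → ∀ n : ℕ, 0 < n →
      iidLaw ν (p μ) n {xs | ¬ ‖mleRaw φ xs - μ‖ ≤ ε * δ} ≤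
        ENNReal.ofReal (2 * m * exp (-c * n * δ ^ 2)) := by
  obtain ⟨r0, hr0, C, hC, hS⟩ := ef_smooth hF hm hK hKM hKn
  set τ := min (r0 / Dm) (ε / (2 * C)) with hτ
  have hτ0 : 0 < τ := by positivity
  have t1 : τ * Dm ≤ r0 := by rw [← le_div_iff₀ hDm]; exact min_le_left _ _
  have t2 : C * τ ≤ ε / 2 := by
    calc C * τ ≤ C * (ε / (2 * C)) := by gcongr; exact min_le_right _ _
      _ = _ := by field_simp
  refine ⟨τ * ε / 2, by positivity, fun μ hμ δ hδ hδD n hn => ?_⟩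
  have hn' : (0:ℝ) < n := by exact_mod_cast hn
  set hv : Fin m × Bool → (Fin m → ℝ) := fun z =>
    Pi.single z.1 (if z.2 then τ * δ else -(τ * δ)) with hvd
  have hvn : ∀ z, ‖hv z‖ = τ * δ := by
    intro z
    rw [hvd]
    simp only [Pi.norm_single]
    split_ifs
    · rw [Real.norm_eq_abs, abs_of_pos (by positivity)]
    · rw [norm_neg, Real.norm_eq_abs, abs_of_pos (by positivity)]
  have hsub : {xs : Fin n → 𝒳 | ¬ ‖mleRaw φ xs - μ‖ ≤ ε * δ} ⊆
      ⋃ z : Fin m × Bool, {xs | τ * δ * (n * (ε * δ)) ≤ ∑ i, dot (hv z) (φ (xs i) - μ)} := by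
    intro xs hxs
    simp only [Set.mem_setOf_eq] at hxs
    rw [pi_norm_le_iff_of_nonneg (by positivity)] at hxs
    push Not at hxs
    obtain ⟨j, hj⟩ := hxs
    have hd : ∀ b : Bool, ∑ i, dot (hv (j, b)) (φ (xs i) - μ) =
        (if b then τ * δ else -(τ * δ)) * (n * (mleRaw φ xs - μ) j) := by
      intro b
      have : ∀ i, dot (hv (j, b)) (φ (xs i) - μ) =
          (if b then τ * δ else -(τ * δ)) * (φ (xs i) j - μ j) := by
        intro i
        simp [hvd, dot, Pi.single_apply]
      simp only [this]
      rw [← Finset.mul_sum, Finset.sum_sub_distrib]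
      congr 1
      simp [mleRaw]
      field_simp
    rw [Real.norm_eq_abs, lt_abs] at hj
    rw [Set.mem_iUnion]
    have hτδ : 0 < τ * δ := by positivity
    rcases hj with hj | hj
    · refine ⟨(j, true), ?_⟩
      simp only [Set.mem_setOf_eq]
      rw [hd]
      simp only [if_true]
      gcongr
    · refine ⟨(j, false), ?_⟩
      simp only [Set.mem_setOf_eq]
      rw [hd]
      simp only [Bool.false_eq_true, if_false]
      have : τ * δ * (n * (ε * δ)) ≤ τ * δ * (n * (-(mleRaw φ xs - μ) j)) := by gcongr
      linarith
  have hz : ∀ z, iidLaw ν (p μ) n {xs | τ * δ * (n * (ε * δ)) ≤ ∑ i, dot (hv z) (φ (xs i) - μ)} ≤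
      ENNReal.ofReal (exp (-(τ * ε / 2) * n * δ ^ 2)) := by
    intro z
    obtain ⟨i1, i2⟩ := hS μ hμ (hv z) (by rw [hvn]; exact le_trans (by gcongr) t1)
    refine (iid_chernoff hF (hKM hμ) n (hv z) _ _ i1 i2).trans (ENNReal.ofReal_le_ofReal ?_)
    rw [← Real.exp_nat_mul, ← exp_add, hvn]
    apply exp_le_exp.2
    have : (C * τ) * (n * τ * δ ^ 2) ≤ ε / 2 * (n * τ * δ ^ 2) := by gcongr
    nlinarith
  calc _ ≤ _ := measure_mono hsub
    _ ≤ ∑ z : Fin m × Bool, _ := measure_iUnion_fintype_le _ _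
    _ ≤ ∑ _z : Fin m × Bool, ENNReal.ofReal (exp (-(τ * ε / 2) * n * δ ^ 2)) :=
        Finset.sum_le_sum fun z _ => hz z
    _ = _ := by
        rw [← ENNReal.ofReal_sum_of_nonneg fun _ _ => (exp_pos _).le]
        congr 1
        simp
        ring

end expfam5
end SwitchPaper
namespace SwitchPaper
section expfam6
variable {𝒳 : Type*} [MeasurableSpace 𝒳] {m : ℕ} {ν : Measure 𝒳} {M : Set (Fin m → ℝ)}
  {p : (Fin m → ℝ) → 𝒳 → ℝ} {θ : (Fin m → ℝ) → (Fin m → ℝ)}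
  {φ : 𝒳 → (Fin m → ℝ)} {ψ : (Fin m → ℝ) → ℝ} {r : 𝒳 → ℝ}

lemma lik_cont (hF : IsMeanValueExpFam ν M p θ φ ψ r) {n : ℕ} (xs : Fin n → 𝒳) :
    ContinuousOn (fun μ => likelihood p μ xs) M := by
  unfold likelihood
  refine continuousOn_finsetProd _ fun i _ => ?_
  have : ContinuousOn (fun μ => exp (dot (θ μ) (φ (xs i)) - ψ (θ μ)) * r (xs i)) M := by
    refine ContinuousOn.mul ?_ continuousOn_const
    refine Real.continuous_exp.comp_continuousOn (ContinuousOn.sub ?_ (ef_ψ_cont hF))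
    exact continuous_dot.comp_continuousOn ((ef_θ_cont hF).prodMk continuousOn_const)
  exact this.congr fun μ hμ => hF.p_form μ hμ _

lemma lik_pos (hF : IsMeanValueExpFam ν M p θ φ ψ r) {n : ℕ} (xs : Fin n → 𝒳) {μ} (hμ : μ ∈ M) :
    0 < likelihood p μ xs := Finset.prod_pos fun i _ => ef_pos hF hμ _

lemma marg_bounds {d : ℕ} {S : Set (Fin d → ℝ)} (hS : IsOpen S) {w L : (Fin d → ℝ) → ℝ}
    (hw : ContinuousOn w S) (hwp : ∀ t ∈ S, 0 < w t) (hwi : ∫ t in S, w t = 1)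
    (hL : ContinuousOn L S) (hLp : ∀ t ∈ S, 0 < L t) {B : ℝ} (hB : ∀ t ∈ S, L t ≤ B) :
    IntegrableOn (fun t => w t * L t) S ∧ 0 < ∫ t in S, w t * L t ∧ ∫ t in S, w t * L t ≤ B := by
  have hwI : IntegrableOn w S := Integrable.of_integral_ne_zero (by rw [hwi]; exact one_ne_zero)
  have hI : IntegrableOn (fun t => w t * L t) S := by
    refine Integrable.mono' (hwI.mul_const B) ((hw.mul hL).aestronglyMeasurable hS.measurableSet) ?_
    refine (ae_restrict_iff' hS.measurableSet).2 (Filter.Eventually.of_forall fun t ht => ?_)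
    rw [Real.norm_of_nonneg (mul_pos (hwp t ht) (hLp t ht)).le]
    exact mul_le_mul_of_nonneg_left (hB t ht) (hwp t ht).le
  refine ⟨hI, ?_, ?_⟩
  · rw [setIntegral_pos_iff_support_of_nonneg_ae _ hI]
    · have h1 : S ⊆ Function.support (fun t => w t * L t) := fun t ht =>
        (mul_pos (hwp t ht) (hLp t ht)).ne'
      rw [Set.inter_eq_right.2 h1, pos_iff_ne_zero]
      intro h0
      rw [setIntegral_measure_zero _ h0] at hwi
      exact zero_ne_one hwi
    · exact (ae_restrict_iff' hS.measurableSet).2 (Filter.Eventually.of_forall fun t ht =>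
        (mul_pos (hwp t ht) (hLp t ht)).le)
  · calc ∫ t in S, w t * L t ≤ ∫ t in S, w t * B :=
          setIntegral_mono_on hI (hwI.mul_const B) hS.measurableSet fun t ht =>
            mul_le_mul_of_nonneg_left (hB t ht) (hwp t ht).le
      _ = B := by rw [integral_mul_const, hwi, one_mul]

lemma switch_lower {pB0 pB1 : (k : ℕ) → (Fin k → 𝒳) → ℝ} {pri : ℕ → ℝ}
    (hp : ∀ t, 0 ≤ pri t) (hs : ∑' t, pri t = 1) (h0 : ∀ k xs, 0 ≤ pB0 k xs)
    (h1 : ∀ k xs, 0 ≤ pB1 k xs) (h00 : ∀ xs, pB0 0 xs = 1) (h10 : ∀ xs, pB1 0 xs = 1)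
    {n : ℕ} (hn : 0 < n) (xs : Fin n → 𝒳) : pri 1 * pB1 n xs ≤ pSwitch pB0 pB1 pri xs := by
  have hps : Summable pri := by
    by_contra h
    rw [tsum_eq_zero_of_not_summable h] at hs
    exact zero_ne_one hs
  have hb : ∀ t, 0 ≤ pBar pB0 pB1 t xs := by
    intro t
    unfold pBar
    split_ifs
    · exact div_nonneg (mul_nonneg (h0 _ _) (h1 _ _)) (h1 _ _)
    · exact h0 _ _
  have hS : Summable fun t => pri t * pBar pB0 pB1 t xs := by
    rw [← summable_nat_add_iff (n + 1)]
    have := ((summable_nat_add_iff (n + 1)).2 hps).mul_right (pB0 n xs)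
    refine this.congr fun t => ?_
    have : ¬ (t + (n + 1) - 1 < n) := by omega
    simp only [pBar, this, dite_false]
  have := hS.le_tsum 1 fun t _ => mul_nonneg (hp t) (hb t)
  have he : pBar pB0 pB1 1 xs = pB1 n xs := by
    unfold pBar
    rw [dif_pos (by omega)]
    rw [show pB0 (1 - 1) (prefixObs xs (1 - 1) (by omega)) = 1 from h00 _,
      show pB1 (1 - 1) (prefixObs xs (1 - 1) (by omega)) = 1 from h10 _]
    simp
  rw [he] at this
  exact this

lemma embed0_cont {m₀ m₁ : ℕ} (h : m₀ ≤ m₁) (fixed : Fin m₁ → ℝ) :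
    Continuous (embed0 h fixed) := by
  refine continuous_pi fun j => ?_
  unfold embed0
  by_cases hj : (j : ℕ) < m₀
  · simp only [hj, dite_true]; exact continuous_apply _
  · simp only [hj, dite_false]; exact continuous_const

lemma embed0_pre {m₀ m₁ : ℕ} (h : m₀ ≤ m₁) (fixed : Fin m₁ → ℝ) (M₁ : Set (Fin m₁ → ℝ)) :
    embed0 h fixed ⁻¹' nestedSub m₀ M₁ fixed = embed0 h fixed ⁻¹' M₁ := by
  ext t
  refine ⟨fun ht => ht.1, fun ht => ⟨ht, fun j hj => ?_⟩⟩
  unfold embed0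
  rw [dif_neg (by omega)]

lemma sqDist_le {m₀ : ℕ} {fixed μ t : Fin m → ℝ} (ht : t ∈ nestedSub m₀ M fixed) :
    sqDist μ (proj0 m₀ fixed μ) ≤ m * ‖t - μ‖ ^ 2 := by
  unfold sqDist proj0
  calc _ ≤ ∑ _j : Fin m, ‖t - μ‖ ^ 2 := by
        refine Finset.sum_le_sum fun j _ => ?_
        split_ifs with h
        · simp
        · rw [← ht.2 j (by omega), ← sq_abs, abs_sub_comm]
          gcongr
          exact norm_le_pi_norm (t - μ) j
    _ = _ := by simp

lemma core {m₀ : ℕ} (hF : IsMeanValueExpFam ν M p θ φ ψ r) (hm : m₀ < m)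
    (fixed : Fin m → ℝ)
    (ω₁ : (Fin m → ℝ) → ℝ) (hω₁c : ContinuousOn ω₁ M) (hω₁pos : ∀ μ ∈ M, 0 < ω₁ μ)
    (hω₁int : (∫ μ in M, ω₁ μ) = 1)
    (ω₀ : (Fin m₀ → ℝ) → ℝ)
    (hω₀c : ContinuousOn ω₀ (embed0 hm.le fixed ⁻¹' nestedSub m₀ M fixed))
    (hω₀pos : ∀ t ∈ embed0 hm.le fixed ⁻¹' nestedSub m₀ M fixed, 0 < ω₀ t)
    (hω₀int : (∫ t in embed0 hm.le fixed ⁻¹' nestedSub m₀ M fixed, ω₀ t) = 1)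
    (pB0 pB1 : (k : ℕ) → (Fin k → 𝒳) → ℝ)
    (hpB1 : ∀ k (xs : Fin k → 𝒳), pB1 k xs = bayesMarginal p M ω₁ xs)
    (hpB0 : ∀ k (xs : Fin k → 𝒳), pB0 k xs =
      bayesMarginal (fun t => p (embed0 hm.le fixed t))
        (embed0 hm.le fixed ⁻¹' nestedSub m₀ M fixed) ω₀ xs)
    (pri : ℕ → ℝ) (hp : ∀ t, 0 ≤ pri t) (hs : ∑' t, pri t = 1)
    {μ : Fin m → ℝ} (hμ : μ ∈ M) {n : ℕ} (hn : 0 < n) (xs : Fin n → 𝒳)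
    (ha : mleRaw φ xs ∈ M) {c w R δ : ℝ} (hR : 0 ≤ R) (hw : 0 ≤ w)
    (hRM : Metric.closedBall μ R ⊆ M) (hRw : ∀ b ∈ Metric.closedBall μ R, w ≤ ω₁ b)
    (hfar : ∀ t ∈ nestedSub m₀ M fixed,
      c * δ ^ 2 ≤ DD θ ψ μ t - dot (θ t - θ μ) (mleRaw φ xs - μ))
    (hnear : ∀ b ∈ Metric.closedBall μ R,
      DD θ ψ μ b - dot (θ b - θ μ) (mleRaw φ xs - μ) ≤ c / 2 * δ ^ 2)
    (hbad : xs ∈ swSelectsSimple pB0 pB1 pri n) :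
    pri 1 * (w * (2 * R) ^ m) ≤ exp (-(c / 2 * n * δ ^ 2)) := by
  set S := embed0 hm.le fixed ⁻¹' nestedSub m₀ M fixed with hSdef
  have hSo : IsOpen S := by
    rw [hSdef, embed0_pre]; exact (ef_isOpen hF).preimage (embed0_cont _ _)
  have hMo := ef_isOpen hF
  have hSM : ∀ t ∈ S, embed0 hm.le fixed t ∈ M := fun t ht => ht.1
  set l := likelihood p μ xs with hl
  have hl0 : 0 < l := lik_pos hF xs hμ
  have hB0 : 0 < pB0 n xs ∧ pB0 n xs ≤ exp (-(c * n * δ ^ 2)) * l := by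
    rw [hpB0]
    refine (marg_bounds hSo hω₀c hω₀pos hω₀int
      (L := fun t => likelihood (fun t => p (embed0 hm.le fixed t)) t xs)
      (B := exp (-(c * n * δ ^ 2)) * l) ?_ ?_ ?_).2
    · exact (lik_cont hF xs).comp (embed0_cont _ _).continuousOn hSM
    · intro t ht; exact lik_pos hF xs (hSM t ht)
    · intro t ht
      have := ef_lik hF hμ (hSM t ht) hn xs
      change likelihood p (embed0 hm.le fixed t) xs ≤ _
      rw [this]
      refine mul_le_mul_of_nonneg_right (exp_le_exp.2 ?_) hl0.le
      have := mul_le_mul_of_nonneg_left (hfar _ ht) (Nat.cast_nonneg (α := ℝ) n)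
      linarith
  have hB1I : IntegrableOn (fun b => ω₁ b * likelihood p b xs) M := by
    refine (marg_bounds hMo hω₁c hω₁pos hω₁int (lik_cont hF xs) (fun t ht => lik_pos hF xs ht)
      (B := likelihood p (mleRaw φ xs) xs) ?_).1
    intro t ht
    rw [ef_lik hF ha ht hn xs]
    refine mul_le_of_le_one_left (lik_pos hF xs ha).le ?_
    rw [sub_self, dot_comm, dot_zero_l, sub_zero]
    apply Real.exp_le_one_iff.2
    have := DD_nonneg hF ha ht
    have : 0 ≤ (n:ℝ) * DD θ ψ (mleRaw φ xs) t := by positivity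
    linarith
  have hB1 : w * (2 * R) ^ m * (exp (-(c / 2 * n * δ ^ 2)) * l) ≤ pB1 n xs := by
    rw [hpB1]
    unfold bayesMarginal
    calc w * (2 * R) ^ m * (exp (-(c / 2 * n * δ ^ 2)) * l)
        = ∫ _b in Metric.closedBall μ R, w * (exp (-(c / 2 * n * δ ^ 2)) * l) := by
          rw [setIntegral_const, Measure.real, Real.volume_pi_closedBall μ hR]
          simp only [Fintype.card_fin, smul_eq_mul]
          rw [ENNReal.toReal_ofReal (by positivity)]
          ring
      _ ≤ ∫ b in Metric.closedBall μ R, ω₁ b * likelihood p b xs := by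
          refine setIntegral_mono_on ?_ (hB1I.mono_set hRM) measurableSet_closedBall fun b hb => ?_
          · exact integrableOn_const (measure_closedBall_lt_top).ne
          · refine mul_le_mul (hRw b hb) ?_ (by positivity) (hω₁pos b (hRM hb)).le
            rw [ef_lik hF hμ (hRM hb) hn xs]
            refine mul_le_mul_of_nonneg_right (exp_le_exp.2 ?_) hl0.le
            have := mul_le_mul_of_nonneg_left (hnear _ hb) (Nat.cast_nonneg (α := ℝ) n)
            linarith
      _ ≤ ∫ b in M, ω₁ b * likelihood p b xs := by
          refine setIntegral_mono_set hB1I ?_ (Filter.Eventually.of_forall hRM)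
          exact (ae_restrict_iff' hMo.measurableSet).2 (Filter.Eventually.of_forall fun t ht =>
            (mul_pos (hω₁pos t ht) (lik_pos hF xs ht)).le)
  have hsw : pri 1 * pB1 n xs ≤ pSwitch pB0 pB1 pri xs := by
    refine switch_lower hp hs ?_ ?_ ?_ ?_ hn xs
    · intro k xs
      rw [hpB0]
      exact setIntegral_nonneg hSo.measurableSet fun t ht =>
        (mul_pos (hω₀pos t ht) (lik_pos hF xs (hSM t ht))).le
    · intro k xs
      rw [hpB1]
      exact setIntegral_nonneg hMo.measurableSet fun t ht =>
        (mul_pos (hω₁pos t ht) (lik_pos hF xs ht)).le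
    · intro xs
      rw [hpB0]
      simpa [bayesMarginal, likelihood] using hω₀int
    · intro xs
      rw [hpB1]
      simpa [bayesMarginal, likelihood] using hω₁int
  have hb : pSwitch pB0 pB1 pri xs ≤ pB0 n xs := by
    have : pSwitch pB0 pB1 pri xs / pB0 n xs ≤ 1 := hbad
    rwa [div_le_one hB0.1] at this
  have h1 : pri 1 * (w * (2 * R) ^ m * (exp (-(c / 2 * n * δ ^ 2)) * l)) ≤
      exp (-(c * n * δ ^ 2)) * l :=
    (mul_le_mul_of_nonneg_left hB1 (hp 1)).trans (hsw.trans (hb.trans hB0.2))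
  have h2 : exp (-(c * n * δ ^ 2)) * l =
      exp (-(c / 2 * n * δ ^ 2)) * (exp (-(c / 2 * n * δ ^ 2)) * l) := by
    rw [← mul_assoc, ← exp_add]; congr 2; ring
  rw [h2, ← mul_assoc] at h1
  exact le_of_mul_le_mul_right h1 (by positivity)

end expfam6
end SwitchPaper
namespace SwitchPaper

/-- Theorem 4: in the nested setting, for every CINECSI subset `M₁'` of
`M₁` there are positive constants `c₁, c₂` and `b₁, b₂, b₃` such that for all `μ₁ ∈ M₁'`
and all `n`, `P_{μ₁}(δ_sw(Xⁿ) = 0) ≤ c₁ n^{m₁/2} e^{−c₂ n‖μ₁−μ₀‖₂²} + small_b(n)` with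
`μ₀ = Π₀(μ₁)`; consequently, with `C' := c₂⁻¹(1 + m₁/2)`, every sequence `μ₁⁽ⁿ⁾` in `M₁'`
with `f(n) = n‖μ₁⁽ⁿ⁾ − Π₀(μ₁⁽ⁿ⁾)‖₂²/log log n > C' log n` has
`P_{μ₁⁽ⁿ⁾}(δ_sw(Xⁿ) = 0) ≤ c₁/n + small_b(n)`. -/
theorem statement_16 {𝒳 : Type*} [MeasurableSpace 𝒳] {m₀ m₁ : ℕ} (hm : m₀ < m₁)
    (ν : Measure 𝒳) [SigmaFinite ν]
    (M₁ : Set (Fin m₁ → ℝ)) (p : (Fin m₁ → ℝ) → 𝒳 → ℝ)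
    (θ : (Fin m₁ → ℝ) → (Fin m₁ → ℝ)) (φ : 𝒳 → (Fin m₁ → ℝ)) (ψ : (Fin m₁ → ℝ) → ℝ)
    (carrier : 𝒳 → ℝ)
    (hF : IsMeanValueExpFam ν M₁ p θ φ ψ carrier)
    (fixed : Fin m₁ → ℝ)
    (hM₀ : (nestedSub m₀ M₁ fixed).Nonempty)
    (M₁' : Set (Fin m₁ → ℝ)) (hM₁' : CINECSI M₁' M₁)
    -- continuous, strictly positive prior densities and the Bayes marginals:
    (ω₁ : (Fin m₁ → ℝ) → ℝ) (hω₁c : ContinuousOn ω₁ M₁) (hω₁pos : ∀ μ ∈ M₁, 0 < ω₁ μ)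
    (hω₁int : (∫ μ in M₁, ω₁ μ) = 1)
    (ω₀ : (Fin m₀ → ℝ) → ℝ)
    (hω₀c : ContinuousOn ω₀ (embed0 hm.le fixed ⁻¹' nestedSub m₀ M₁ fixed))
    (hω₀pos : ∀ t ∈ embed0 hm.le fixed ⁻¹' nestedSub m₀ M₁ fixed, 0 < ω₀ t)
    (hω₀int : (∫ t in embed0 hm.le fixed ⁻¹' nestedSub m₀ M₁ fixed, ω₀ t) = 1)
    (pB0 pB1 : (k : ℕ) → (Fin k → 𝒳) → ℝ)
    (hpB1 : ∀ k (xs : Fin k → 𝒳), pB1 k xs = bayesMarginal p M₁ ω₁ xs)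
    (hpB0 : ∀ k (xs : Fin k → 𝒳), pB0 k xs =
      bayesMarginal (fun t => p (embed0 hm.le fixed t))
        (embed0 hm.le fixed ⁻¹' nestedSub m₀ M₁ fixed) ω₀ xs)
    -- switch prior on switching times:
    (pri : ℕ → ℝ) (κ : ℝ) (hκ : 2 ≤ κ) (hpri : SwitchPrior pri κ) :
    ∃ c₁ > (0:ℝ), ∃ c₂ > (0:ℝ), ∃ b₁ > (0:ℝ), ∃ b₂ > (0:ℝ), ∃ b₃ > (0:ℝ),
      (∀ μ₁ ∈ M₁', ∀ n : ℕ,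
        (iidLaw ν (p μ₁) n) (swSelectsSimple pB0 pB1 pri n)
          ≤ ENNReal.ofReal
              (c₁ * (n : ℝ) ^ ((m₁ : ℝ) / 2) *
                  Real.exp (-c₂ * n * sqDist μ₁ (proj0 m₀ fixed μ₁))
                + smallFn b₁ b₂ b₃ n)) ∧
      (∀ μseq : ℕ → (Fin m₁ → ℝ), (∀ n, μseq n ∈ M₁') →
        (∀ n : ℕ, 3 ≤ n →
          c₂⁻¹ * (1 + (m₁ : ℝ) / 2) * Real.log n <
            (n : ℝ) * sqDist (μseq n) (proj0 m₀ fixed (μseq n)) /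
              Real.log (Real.log n)) →
        ∀ n : ℕ, 3 ≤ n →
          (iidLaw ν (p (μseq n)) n) (swSelectsSimple pB0 pB1 pri n)
            ≤ ENNReal.ofReal (c₁ / n + smallFn b₁ b₂ b₃ n)) := by
  have hm0 : 0 < m₁ := by omega
  have hmR : (0:ℝ) < m₁ := by exact_mod_cast hm0
  obtain ⟨hKc, hKi, hK, -⟩ := hM₁'
  have hKn := hKc.nonempty
  have hKM : M₁' ⊆ M₁ := hKi.trans interior_subset
  obtain ⟨hp, hs, -, hp1, -⟩ := hpri
  set Δ : (Fin m₁ → ℝ) → ℝ := fun μ => sqDist μ (proj0 m₀ fixed μ) with hΔ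
  have hΔ0 : ∀ μ, 0 ≤ Δ μ := fun μ => Finset.sum_nonneg fun j _ => sq_nonneg _
  -- upper bound for delta
  obtain ⟨Dm, hDm, hD⟩ : ∃ Dm > 0, ∀ μ ∈ M₁', √(Δ μ / m₁) ≤ Dm := by
    obtain ⟨B, hB, hBK⟩ := ef_bdd hF hK hKM
    obtain ⟨t, ht⟩ := hM₀
    refine ⟨‖t‖ + B, by positivity, fun μ hμ => ?_⟩
    refine Real.sqrt_le_iff.2 ⟨by positivity, ?_⟩
    rw [div_le_iff₀ hmR, mul_comm]
    refine (sqDist_le ht).trans ?_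
    have h1 : ‖t - μ‖ ≤ ‖t‖ + B := (norm_sub_le _ _).trans (by linarith [(hBK μ hμ).2.2])
    gcongr
  obtain ⟨ρ1, hρ1, hsub⟩ := hK.exists_cthickening_subset_open (ef_isOpen hF) hKM
  have hball : ∀ μ ∈ M₁', ∀ b, ‖b - μ‖ ≤ ρ1 → b ∈ Metric.cthickening ρ1 M₁' := fun μ hμ b hb =>
    Metric.mem_cthickening_of_dist_le b μ ρ1 _ hμ (by rwa [dist_eq_norm])
  obtain ⟨w, hw, hwb⟩ : ∃ w > 0, ∀ b ∈ Metric.cthickening ρ1 M₁', w ≤ ω₁ b := by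
    have hne : (Metric.cthickening ρ1 M₁').Nonempty := by
      obtain ⟨μ, hμ⟩ := hKn
      exact ⟨μ, hball μ hμ μ (by simpa using hρ1.le)⟩
    obtain ⟨b0, hb0, hmin⟩ := (hK.cthickening (r := ρ1)).exists_isMinOn hne (hω₁c.mono hsub)
    exact ⟨ω₁ b0, hω₁pos _ (hsub hb0), fun b hb => hmin hb⟩
  obtain ⟨ε, hε, -, c, hc, hfar⟩ := ef_far hF hm0 hK hKM hKn hDm
  obtain ⟨ρ, hρ, hρD, hnear⟩ := ef_near hF hK hKM hKn hDm (η := c / 2) (by positivity) hρ1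
  set ε' := min 1 (min ε (ρ1 / Dm)) with hε'
  have hε'0 : 0 < ε' := by positivity
  obtain ⟨c3, hc3, hconc⟩ := iid_conc hF hm0 hK hKM hKn hDm hε'0
  set c₂ := min (c / 2) c3 / m₁ with hc₂
  have hc₂0 : 0 < c₂ := by positivity
  set Q := pri 1 * (w * (2 * ρ) ^ m₁) with hQ
  have hQ0 : 0 < Q := by positivity
  set c₁ := exp (c₂ * m₁) + Q⁻¹ + 2 * m₁ with hc₁
  have hc₁0 : 0 < c₁ := by positivity
  have hmain : ∀ μ₁ ∈ M₁', ∀ n : ℕ, 0 < n →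
      (iidLaw ν (p μ₁) n) (swSelectsSimple pB0 pB1 pri n)
        ≤ ENNReal.ofReal (c₁ * (n : ℝ) ^ ((m₁ : ℝ) / 2) * Real.exp (-c₂ * n * Δ μ₁)) := by
    intro μ hμ n hn
    have hnR : (1:ℝ) ≤ n := by exact_mod_cast hn
    have hn1 : (1:ℝ) ≤ (n:ℝ) ^ ((m₁ : ℝ) / 2) := Real.one_le_rpow hnR (by positivity)
    set δ := √(Δ μ / m₁) with hδ
    have hδ0 : 0 ≤ δ := Real.sqrt_nonneg _
    have hδ2 : δ ^ 2 = Δ μ / m₁ := Real.sq_sqrt (div_nonneg (hΔ0 μ) hmR.le)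
    have hΔδ : Δ μ = m₁ * δ ^ 2 := by rw [hδ2]; field_simp
    have hcm : c₂ * m₁ = min (c / 2) c3 := by rw [hc₂]; field_simp
    have hexp : -c₂ * n * Δ μ = -(min (c / 2) c3 * (n * δ ^ 2)) := by
      rw [hΔδ, ← hcm]; ring
    rw [hexp]
    have triv : 1 ≤ c₁ * (n : ℝ) ^ ((m₁ : ℝ) / 2) * exp (-(min (c / 2) c3 * (n * δ ^ 2))) →
        (iidLaw ν (p μ) n) (swSelectsSimple pB0 pB1 pri n) ≤ ENNReal.ofReal
          (c₁ * (n : ℝ) ^ ((m₁ : ℝ) / 2) * exp (-(min (c / 2) c3 * (n * δ ^ 2)))) := fun h =>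
      (iid_le_one hF (hKM hμ) n _).trans (ENNReal.one_le_ofReal.2 h)
    by_cases hsmall : n * δ ^ 2 < 1
    · apply triv
      calc (1:ℝ) = exp (c₂ * m₁) * 1 * exp (-(c₂ * m₁)) := by
            rw [mul_one, ← exp_add, add_neg_cancel, exp_zero]
        _ ≤ _ := by
            have h1 : exp (c₂ * m₁) ≤ c₁ := by
              have : 0 ≤ Q⁻¹ := by positivity
              rw [hc₁]; linarith
            have h2 : exp (-(c₂ * m₁)) ≤ exp (-(min (c / 2) c3 * (n * δ ^ 2))) := by
              apply exp_le_exp.2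
              rw [hcm]
              have : 0 < min (c / 2) c3 := by positivity
              nlinarith
            gcongr
    push Not at hsmall
    have hδp : 0 < δ := by
      rcases hδ0.eq_or_lt with h | h
      · rw [← h] at hsmall; norm_num at hsmall
      · exact h
    have hδD : δ ≤ Dm := hD μ hμ
    by_cases hex : Q * δ ^ m₁ ≤ exp (-(c / 2 * n * δ ^ 2))
    · apply triv
      have h3 : 1 ≤ (n:ℝ) ^ ((m₁ : ℝ) / 2) * δ ^ m₁ := by
        have h4 : (n:ℝ) ^ ((m₁ : ℝ) / 2) * δ ^ m₁ = (n * δ ^ 2) ^ ((m₁ : ℝ) / 2) := by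
          rw [Real.mul_rpow (by positivity) (by positivity), ← Real.rpow_natCast δ 2,
            ← Real.rpow_mul hδ0, ← Real.rpow_natCast δ m₁]
          congr 2
          push_cast; ring
        rw [h4]
        exact Real.one_le_rpow hsmall (by positivity)
      have h5 : exp (-(c / 2 * n * δ ^ 2)) ≤ exp (-(min (c / 2) c3 * (n * δ ^ 2))) := by
        apply exp_le_exp.2
        have := mul_le_mul_of_nonneg_right (min_le_left (c / 2) c3)
          (show 0 ≤ n * δ ^ 2 by positivity)
        linarith
      calc (1:ℝ) ≤ (n:ℝ) ^ ((m₁ : ℝ) / 2) * δ ^ m₁ := h3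
        _ = Q⁻¹ * (n:ℝ) ^ ((m₁ : ℝ) / 2) * (Q * δ ^ m₁) := by field_simp
        _ ≤ c₁ * (n : ℝ) ^ ((m₁ : ℝ) / 2) * exp (-(min (c / 2) c3 * (n * δ ^ 2))) := by
            have h1 : Q⁻¹ ≤ c₁ := by
              rw [hc₁]; have := exp_pos (c₂ * m₁); linarith
            have h6 := hex.trans h5
            gcongr
    have hsubset : swSelectsSimple pB0 pB1 pri n ⊆ {xs | ¬ ‖mleRaw φ xs - μ‖ ≤ ε' * δ} := by
      intro xs hbad hE
      apply hex
      have hE1 : ‖mleRaw φ xs - μ‖ ≤ ε * δ := hE.trans (by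
        have : ε' ≤ ε := (min_le_right _ _).trans (min_le_left _ _)
        gcongr)
      have hE2 : ‖mleRaw φ xs - μ‖ ≤ ρ1 := hE.trans (by
        have : ε' ≤ ρ1 / Dm := (min_le_right _ _).trans (min_le_right _ _)
        calc ε' * δ ≤ ρ1 / Dm * Dm := by gcongr
          _ = ρ1 := by field_simp)
      have hE3 : ‖mleRaw φ xs - μ‖ ≤ δ := hE.trans (by
        have : ε' ≤ 1 := min_le_left _ _
        nlinarith)
      have hcb : ∀ b ∈ Metric.closedBall μ (ρ * δ), b ∈ Metric.cthickening ρ1 M₁' := by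
        intro b hb
        rw [Metric.mem_closedBall, dist_eq_norm] at hb
        refine hball μ hμ b (hb.trans (le_trans ?_ hρD))
        gcongr
      have := core hF hm fixed ω₁ hω₁c hω₁pos hω₁int ω₀ hω₀c hω₀pos hω₀int pB0 pB1 hpB1 hpB0
        pri hp hs (hKM hμ) hn xs (hsub (hball μ hμ _ hE2)) (c := c) (w := w) (R := ρ * δ) (δ := δ)
        (by positivity) hw.le (fun b hb => hsub (hcb b hb)) (fun b hb => hwb b (hcb b hb))
        (fun t ht => hfar μ hμ t ht.1 δ hδ0 hδD (by
          refine Real.sqrt_le_iff.2 ⟨norm_nonneg _, ?_⟩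
          rw [div_le_iff₀ hmR, mul_comm]
          exact sqDist_le ht) _ hE1)
        (fun b hb => hnear μ hμ b (hsub (hcb b hb)) δ hδ0 hδD (by
          rwa [Metric.mem_closedBall, dist_eq_norm] at hb) _ hE3) hbad
      have he : pri 1 * (w * (2 * (ρ * δ)) ^ m₁) = Q * δ ^ m₁ := by
        rw [hQ, ← mul_assoc 2, mul_pow]; ring
      rwa [he] at this
    refine (measure_mono hsubset).trans ((hconc μ hμ δ hδp hδD n hn).trans
      (ENNReal.ofReal_le_ofReal ?_))
    calc 2 * (m₁:ℝ) * exp (-c3 * n * δ ^ 2) = 2 * (m₁:ℝ) * 1 * exp (-c3 * n * δ ^ 2) := by ring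
      _ ≤ _ := by
        have h1 : 2 * (m₁:ℝ) ≤ c₁ := by
          have : 0 ≤ Q⁻¹ := by positivity
          rw [hc₁]; have := exp_pos (c₂ * m₁); linarith
        have h5 : exp (-c3 * n * δ ^ 2) ≤ exp (-(min (c / 2) c3 * (n * δ ^ 2))) := by
          apply exp_le_exp.2
          have := mul_le_mul_of_nonneg_right (min_le_right (c / 2) c3)
            (show 0 ≤ n * δ ^ 2 by positivity)
          linarith
        gcongr
  have hsm : ∀ n : ℕ, 0 ≤ smallFn 16 1 1 n := by
    intro n; unfold smallFn; split_ifs <;> positivity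
  have hsm1 : ∀ n : ℕ, n < 16 → smallFn 16 1 1 n = 1 := by
    intro n hn; unfold smallFn; rw [if_pos (by exact_mod_cast hn)]
  refine ⟨c₁, hc₁0, c₂, hc₂0, 16, by norm_num, 1, one_pos, 1, one_pos, ?_, ?_⟩
  · intro μ hμ n
    by_cases hn : n < 16
    · refine (iid_le_one hF (hKM hμ) n _).trans (ENNReal.one_le_ofReal.2 ?_)
      rw [hsm1 n hn]
      have : 0 ≤ c₁ * (n : ℝ) ^ ((m₁ : ℝ) / 2) *
        exp (-c₂ * n * sqDist μ (proj0 m₀ fixed μ)) := by positivity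
      linarith
    · refine (hmain μ hμ n (by omega)).trans (ENNReal.ofReal_le_ofReal ?_)
      have := hsm n
      simp only [hΔ]
      linarith
  · intro μs hμs hf n hn3
    by_cases hn : n < 16
    · refine (iid_le_one hF (hKM (hμs n)) n _).trans (ENNReal.one_le_ofReal.2 ?_)
      rw [hsm1 n hn]
      have : 0 ≤ c₁ / n := by positivity
      linarith
    · refine (hmain _ (hμs n) n (by omega)).trans (ENNReal.ofReal_le_ofReal ?_)
      have hsn := hsm n
      have hn16 : (16:ℝ) ≤ n := by exact_mod_cast (not_lt.1 hn)
      have hnp : (0:ℝ) < n := by linarith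
      have hlog : exp 1 ≤ Real.log n := by
        have h1 : Real.log 16 ≤ Real.log n := Real.log_le_log (by norm_num) hn16
        have h2 : Real.log 16 = 4 * Real.log 2 := by
          rw [show (16:ℝ) = 2 ^ 4 by norm_num, Real.log_pow]; norm_num
        have h3 := Real.log_two_gt_d9
        have h4 := Real.exp_one_lt_d9
        linarith
      have hll : 1 ≤ Real.log (Real.log n) := by
        rw [Real.le_log_iff_exp_le ((exp_pos 1).trans_le hlog)]; exact hlog
      have h1 := hf n hn3
      have h2 : (n : ℝ) * Δ (μs n) / Real.log (Real.log n) ≤ n * Δ (μs n) :=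
        div_le_self (mul_nonneg hnp.le (hΔ0 _)) hll
      have h3 : c₂⁻¹ * (1 + (m₁ : ℝ) / 2) * Real.log n ≤ n * Δ (μs n) := h1.le.trans h2
      have h4 : (1 + (m₁ : ℝ) / 2) * Real.log n ≤ c₂ * (n * Δ (μs n)) := by
        calc _ = c₂ * (c₂⁻¹ * (1 + (m₁ : ℝ) / 2) * Real.log n) := by field_simp
          _ ≤ _ := by gcongr
      have h5 : (n : ℝ) ^ ((m₁ : ℝ) / 2) * exp (-c₂ * n * Δ (μs n)) ≤ (n:ℝ)⁻¹ := by
        rw [Real.rpow_def_of_pos hnp, ← exp_add]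
        calc _ ≤ exp (-Real.log n) := by
              apply exp_le_exp.2
              linarith
          _ = _ := by rw [exp_neg, Real.exp_log hnp]
      have h6 := mul_le_mul_of_nonneg_left h5 hc₁0.le
      rw [← mul_assoc] at h6
      rw [← div_eq_mul_inv] at h6
      linarith

end SwitchPaper
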